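/- Let (Q_n)_n be a sequence of probability distributions on ℝ^d with finite first moments such that D_1(Q_n, Q) → 0 for some probability distribution Q on ℝ^d with finite first moment. Then lim_{n→∞} L(Q_n) = L(Q) (in [−∞, ∞]). If in addition csupp(Q) has nonempty interior, then the probability densities f := exp∘ψ(·|Q) and f_n := exp∘ψ(·|Q_n) are well defined for all sufficiently large n, and: lim_{n→∞, x→y} f_n(x) = f(y) for all y ∈ ℝ^d \ ∂{f > 0}; limsup_{n→∞, x→y} f_n(x) ≤ f(y) for all y ∈ ∂{f > 0}; and lim_{n→∞} ∫ |f_n(x) − f(x)| dx = 0. -/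

import Mathlib

open MeasureTheory Filter Topology Set
open scoped ENNReal RealInnerProductSpace BoundedContinuousFunction

noncomputable section

/-- Truncation of an extended real number to `ℝ≥0∞`. -/
def EReal.toENN (x : EReal) : ℝ≥0∞ := if x = ⊤ then ⊤ else ENNReal.ofReal x.toReal

/-- The real-valued exponential of an extended real number (`⊤` is sent to `0`,
but this value is never used for functions in the class `Φ`). -/
def EReal.expR (x : EReal) : ℝ := (EReal.exp x).toReal

/-- The class `Φ(d)`: upper semicontinuous, concave functions `φ : E → [-∞, ∞)`
which are coercive in the sense that `φ x → -∞` as `‖x‖ → ∞`. -/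
def IsPhi {E : Type*} [NormedAddCommGroup E] [NormedSpace ℝ E] (φ : E → EReal) : Prop :=
  UpperSemicontinuous φ ∧ (∀ x, φ x ≠ ⊤) ∧
  (∀ x y : E, ∀ a b : ℝ, 0 < a → 0 < b → a + b = 1 →
    (a : EReal) * φ x + (b : EReal) * φ y ≤ φ (a • x + b • y)) ∧
  Tendsto φ (Filter.comap (fun x : E => ‖x‖) atTop) (𝓝 ⊥)

/-- The integral of an `EReal`-valued function with respect to a measure,
defined as the difference of the integrals of the positive and negative parts. -/
def eint {E : Type*} [MeasurableSpace E] (Q : Measure E) (φ : E → EReal) : EReal :=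
  ((∫⁻ x, (φ x).toENN ∂Q : ℝ≥0∞) : EReal) - ((∫⁻ x, (-(φ x)).toENN ∂Q : ℝ≥0∞) : EReal)

/-- The log-likelihood-type functional `L(φ, Q) = ∫ φ dQ - ∫ e^{φ(x)} dx + 1`. -/
def Lfun {E : Type*} [NormedAddCommGroup E] [NormedSpace ℝ E] [MeasureSpace E]
    (φ : E → EReal) (Q : Measure E) : EReal :=
  eint Q φ - ((∫⁻ x, EReal.exp (φ x) : ℝ≥0∞) : EReal) + 1

/-- The profile log-likelihood `L(Q) = sup_{φ ∈ Φ} L(φ, Q)`. -/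
def Lprof {E : Type*} [NormedAddCommGroup E] [NormedSpace ℝ E] [MeasureSpace E]
    (Q : Measure E) : EReal :=
  ⨆ φ ∈ {φ : E → EReal | IsPhi φ}, Lfun φ Q

/-- The convex support of a measure: the intersection of all closed convex sets of full
measure. -/
def csupp {E : Type*} [NormedAddCommGroup E] [NormedSpace ℝ E] [MeasurableSpace E]
    (Q : Measure E) : Set E :=
  ⋂₀ {C : Set E | IsClosed C ∧ Convex ℝ C ∧ Q C = 1}

/-- `ψ` is the (a) maximizer of `L(·, Q)` over `Φ`, i.e. `ψ = ψ(·|Q)`. -/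
def IsMLE {E : Type*} [NormedAddCommGroup E] [NormedSpace ℝ E] [MeasureSpace E]
    (Q : Measure E) (ψ : E → EReal) : Prop :=
  IsPhi ψ ∧ ∀ φ : E → EReal, IsPhi φ → Lfun φ Q ≤ Lfun ψ Q

/-- Weak convergence of a sequence of measures. -/
def WConv {E : Type*} [NormedAddCommGroup E] [MeasurableSpace E]
    (Qn : ℕ → Measure E) (Q : Measure E) : Prop :=
  ∀ g : E →ᵇ ℝ, Tendsto (fun n => ∫ x, g x ∂(Qn n)) atTop (𝓝 (∫ x, g x ∂Q))

/-- The Mallows (Wasserstein-1, Kantorovich–Rubinstein) distance. -/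
def D1 {E : Type*} [NormedAddCommGroup E] [MeasurableSpace E] (Q Q' : Measure E) : ℝ :=
  sSup {r : ℝ | ∃ h : E → ℝ, LipschitzWith 1 h ∧ r = |(∫ x, h x ∂Q) - ∫ x, h x ∂Q'|}

/-- The bounded Lipschitz distance. -/
def DBL (Q Q' : Measure ℝ) : ℝ :=
  sSup {r : ℝ | ∃ h : ℝ → ℝ, (∀ x, |h x| ≤ 1) ∧ LipschitzWith 1 h ∧
    r = |(∫ x, h x ∂Q) - ∫ x, h x ∂Q'|}

/-- The Kolmogorov–Smirnov distance. -/
def DKS (Q Q' : Measure ℝ) : ℝ :=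
  ⨆ t : ℝ, |(Q' (Set.Iic t)).toReal - (Q (Set.Iic t)).toReal|

/-- Convolution of two measures. -/
def mconv {E : Type*} [NormedAddCommGroup E] [MeasurableSpace E] (Q R : Measure E) : Measure E :=
  (Q.prod R).map (fun p => p.1 + p.2)

/-- The empirical measure of a finite tuple of real numbers. -/
def empQ {n : ℕ} (v : Fin n → ℝ) : Measure ℝ :=
  ((n : ℝ≥0∞))⁻¹ • ∑ i, Measure.dirac (v i)

end

namespace LCD

/-- The likelihood functional, rewritten as a nonnegative quantity (smaller is better). -/
noncomputable def Vf {E : Type*} [NormedAddCommGroup E] [NormedSpace ℝ E] [MeasureSpace E]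
    (M : ℝ) (φ : E → EReal) (Q : Measure E) : ℝ≥0∞ :=
  ∫⁻ x, ((M : EReal) - φ x).toENNReal ∂Q + ∫⁻ x, EReal.exp (φ x)

lemma toENN_eq (x : EReal) : x.toENN = x.toENNReal := rfl

lemma pt_identity (M : ℝ) (t : EReal) (ht : t ≤ M) :
    ((M : EReal) - t).toENNReal + t.toENNReal + ENNReal.ofReal (-M)
      = ENNReal.ofReal M + (-t).toENNReal := by
  induction t with
  | bot => simp
  | top => simp at ht
  | coe t =>
    have ht' : t ≤ M := by exact_mod_cast ht
    rw [← EReal.coe_sub, ← EReal.coe_neg]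
    simp only [EReal.toENNReal_of_ne_top (EReal.coe_ne_top _), EReal.toReal_coe]
    rw [← ENNReal.toReal_eq_toReal_iff' (by finiteness) (by finiteness)]
    rw [ENNReal.toReal_add (by finiteness) (by finiteness),
      ENNReal.toReal_add (by finiteness) (by finiteness),
      ENNReal.toReal_add (by finiteness) (by finiteness)]
    simp only [ENNReal.toReal_ofReal']
    rcases le_total 0 M with h | h <;> rcases le_total 0 t with h' | h' <;>
      simp [h, h', ht'] <;> linarith

lemma eint_eq {E : Type*} [MeasurableSpace E] (Q : Measure E) [IsProbabilityMeasure Q]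
    (M : ℝ) (φ : E → EReal) (hφ : Measurable φ) (hM : ∀ x, φ x ≤ M) :
    eint Q φ = (M : EReal) - ((∫⁻ x, ((M : EReal) - φ x).toENNReal ∂Q : ℝ≥0∞) : EReal) := by
  have key : ∫⁻ x, ((M : EReal) - φ x).toENNReal ∂Q + ∫⁻ x, (φ x).toENNReal ∂Q
      + ENNReal.ofReal (-M) = ENNReal.ofReal M + ∫⁻ x, (-(φ x)).toENNReal ∂Q := by
    have h := lintegral_congr (μ := Q) (fun x => pt_identity M (φ x) (hM x))
    rw [lintegral_add_right _ measurable_const, lintegral_add_right _ (by fun_prop),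
      lintegral_add_left measurable_const] at h
    simpa using h
  have hP : ∫⁻ x, (φ x).toENNReal ∂Q ≠ ⊤ := by
    have : ∫⁻ x, (φ x).toENNReal ∂Q ≤ ∫⁻ x, ENNReal.ofReal M ∂Q := by
      apply lintegral_mono
      intro x
      exact EReal.toENNReal_le_toENNReal (hM x)
    refine ne_top_of_le_ne_top ?_ this
    simp
  unfold eint
  simp only [toENN_eq]
  generalize ∫⁻ x, (φ x).toENNReal ∂Q = P at *
  generalize ∫⁻ x, (-(φ x)).toENNReal ∂Q = N at *
  generalize ∫⁻ x, ((M : EReal) - φ x).toENNReal ∂Q = G at *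
  by_cases hN : N = ⊤
  · have hG : G = ⊤ := by
      by_contra h
      subst hN
      simp only [add_top] at key
      have : G + P + ENNReal.ofReal (-M) ≠ ⊤ := by finiteness
      exact this key
    subst hN hG
    lift P to NNReal using hP
    simp [sub_eq_add_neg]
  · have hG : G ≠ ⊤ := by
      intro h
      subst h
      simp only [top_add] at key
      have : ENNReal.ofReal M + N ≠ ⊤ := by finiteness
      exact this key.symm
    have k2 := congrArg ENNReal.toReal key
    rw [ENNReal.toReal_add (by finiteness) (by finiteness),
      ENNReal.toReal_add (by finiteness) (by finiteness),
      ENNReal.toReal_add (by finiteness) (by finiteness)] at k2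
    simp only [ENNReal.toReal_ofReal'] at k2
    rw [← EReal.coe_ennreal_toReal hP, ← EReal.coe_ennreal_toReal hN,
      ← EReal.coe_ennreal_toReal hG]
    rw [← EReal.coe_sub, ← EReal.coe_sub]
    congr 1
    rcases le_total 0 M with h | h <;> simp [h] at k2 <;> linarith

section
variable {E : Type*} [NormedAddCommGroup E] [NormedSpace ℝ E] [MeasureSpace E]

lemma Lfun_eq (Q : Measure E) [IsProbabilityMeasure Q]
    (M : ℝ) (φ : E → EReal) (hφ : Measurable φ) (hM : ∀ x, φ x ≤ M) :
    Lfun φ Q = ((M + 1 : ℝ) : EReal) - (Vf M φ Q : EReal) := by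
  unfold Lfun Vf
  rw [eint_eq Q M φ hφ hM]
  generalize ∫⁻ x, ((M : EReal) - φ x).toENNReal ∂Q = A
  generalize ∫⁻ x, EReal.exp (φ x) = B
  induction A with
  | top => simp [sub_eq_add_neg]
  | coe A =>
    induction B with
    | top => simp [sub_eq_add_neg]
    | coe B =>
      rw [← ENNReal.coe_add]
      change (M : EReal) - ((A : ℝ) : EReal) - ((B : ℝ) : EReal) + ((1 : ℝ) : EReal)
        = ((M + 1 : ℝ) : EReal) - (((A + B : NNReal) : ℝ) : EReal)
      rw [← EReal.coe_sub, ← EReal.coe_sub, ← EReal.coe_sub, ← EReal.coe_add]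
      congr 1
      push_cast
      ring

lemma le_Lfun_iff (Q : Measure E) [IsProbabilityMeasure Q]
    (M : ℝ) (φ : E → EReal) (hφ : Measurable φ) (hM : ∀ x, φ x ≤ M) (c : ℝ) :
    (c : EReal) ≤ Lfun φ Q ↔ ((Vf M φ Q : ℝ≥0∞) : EReal) ≤ ((M + 1 - c : ℝ) : EReal) := by
  rw [Lfun_eq Q M φ hφ hM]
  generalize Vf M φ Q = V
  induction V with
  | top =>
    have := EReal.coe_ne_top (M + 1 - c)
    simp only [EReal.coe_ennreal_top, top_le_iff, this, iff_false]
    simp [sub_eq_add_neg]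
  | coe V =>
    change (c : EReal) ≤ ((M + 1 : ℝ) : EReal) - ((V : ℝ) : EReal) ↔
      ((V : ℝ) : EReal) ≤ ((M + 1 - c : ℝ) : EReal)
    rw [← EReal.coe_sub, EReal.coe_le_coe_iff, EReal.coe_le_coe_iff]
    constructor <;> intro h <;> linarith

lemma le_Lfun_iff' (Q : Measure E) [IsProbabilityMeasure Q]
    (M : ℝ) (φ : E → EReal) (hφ : Measurable φ) (hM : ∀ x, φ x ≤ M) (c : ℝ) :
    (c : EReal) ≤ Lfun φ Q ↔ (0 ≤ M + 1 - c ∧ Vf M φ Q ≤ ENNReal.ofReal (M + 1 - c)) := by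
  rw [le_Lfun_iff Q M φ hφ hM c]
  generalize Vf M φ Q = V
  constructor
  · intro h
    have h0 : 0 ≤ M + 1 - c := by
      have := (EReal.coe_ennreal_nonneg V).trans h
      exact_mod_cast this
    refine ⟨h0, ?_⟩
    rw [← EReal.coe_ennreal_le_coe_ennreal_iff, EReal.coe_ennreal_ofReal, max_eq_left h0]
    exact h
  · rintro ⟨h0, h⟩
    rw [← EReal.coe_ennreal_le_coe_ennreal_iff, EReal.coe_ennreal_ofReal, max_eq_left h0] at h
    exact h

lemma Lfun_lt_top (Q : Measure E) [IsProbabilityMeasure Q]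
    (M : ℝ) (φ : E → EReal) (hφ : Measurable φ) (hM : ∀ x, φ x ≤ M) : Lfun φ Q < ⊤ := by
  rw [Lfun_eq Q M φ hφ hM]
  generalize Vf M φ Q = V
  induction V with
  | top => simp [sub_eq_add_neg]
  | coe V =>
    change ((M + 1 : ℝ) : EReal) - ((V : ℝ) : EReal) < ⊤
    rw [← EReal.coe_sub]
    exact EReal.coe_lt_top _

end

section
variable {E : Type*} [NormedAddCommGroup E] [NormedSpace ℝ E]

/-- working form of concavity -/
def ConcE (φ : E → EReal) : Prop :=
  ∀ x y : E, ∀ a b α β : ℝ, 0 ≤ a → 0 ≤ b → a + b = 1 → (α : EReal) ≤ φ x → (β : EReal) ≤ φ y →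
    ((a * α + b * β : ℝ) : EReal) ≤ φ (a • x + b • y)

lemma _root_.IsPhi.conc {φ : E → EReal} (h : IsPhi φ) : ConcE φ := by
  intro x y a b α β ha hb hab hα hβ
  rcases ha.eq_or_lt with rfl | ha
  · have : b = 1 := by linarith
    subst this
    simpa using hβ
  rcases hb.eq_or_lt with rfl | hb
  · have : a = 1 := by linarith
    subst this
    simpa using hα
  refine le_trans ?_ (h.2.2.1 x y a b ha hb hab)
  rw [EReal.coe_add, EReal.coe_mul, EReal.coe_mul]
  exact add_le_add (mul_le_mul_of_nonneg_left hα (by exact_mod_cast ha.le))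
    (mul_le_mul_of_nonneg_left hβ (by exact_mod_cast hb.le))

lemma concE_toDef {φ : E → EReal} (h : ConcE φ) (ht : ∀ x, φ x ≠ ⊤) (x y : E) (a b : ℝ)
    (ha : 0 < a) (hb : 0 < b) (hab : a + b = 1) :
    (a : EReal) * φ x + (b : EReal) * φ y ≤ φ (a • x + b • y) := by
  rcases eq_or_ne (φ x) ⊥ with hx | hx
  · rw [hx, EReal.coe_mul_bot_of_pos ha]; simp
  rcases eq_or_ne (φ y) ⊥ with hy | hy
  · rw [hy, EReal.coe_mul_bot_of_pos hb]; simp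
  have := h x y a b (φ x).toReal (φ y).toReal ha.le hb.le hab
    (by rw [EReal.coe_toReal (ht x) hx]) (by rw [EReal.coe_toReal (ht y) hy])
  rw [EReal.coe_add, EReal.coe_mul, EReal.coe_mul, EReal.coe_toReal (ht x) hx,
    EReal.coe_toReal (ht y) hy] at this
  exact this

lemma isPhi_of {φ : E → EReal} (hu : UpperSemicontinuous φ) (hc : ConcE φ) (a b : ℝ) (hb : 0 < b)
    (hab : ∀ x, φ x ≤ ((a - b * ‖x‖ : ℝ) : EReal)) : IsPhi φ := by
  have ht : ∀ x, φ x ≠ ⊤ := fun x => ((hab x).trans_lt (EReal.coe_lt_top _)).ne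
  refine ⟨hu, ht, fun x y a b ha hb hab => concE_toDef hc ht x y a b ha hb hab, ?_⟩
  rw [EReal.tendsto_nhds_bot_iff_real]
  intro c
  have h1 : Tendsto (fun x : E => ‖x‖) (Filter.comap (fun x : E => ‖x‖) atTop) atTop :=
    tendsto_comap
  filter_upwards [h1.eventually_gt_atTop ((a - c) / b)] with x hx
  refine (hab x).trans_lt ?_
  rw [div_lt_iff₀ hb] at hx
  have : a - b * ‖x‖ < c := by linarith
  exact_mod_cast this

lemma ConcE.convex_level {φ : E → EReal} (h : ConcE φ) (s : ℝ) : Convex ℝ {x | (s : EReal) ≤ φ x} := by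
  intro x hx y hy a b ha hb hab
  have := h x y a b s s ha hb hab hx hy
  rw [← add_mul, hab, one_mul] at this
  exact this

lemma ConcE.convex_dom {φ : E → EReal} (h : ConcE φ) : Convex ℝ {x | ⊥ < φ x} := by
  intro x hx y hy a b ha hb hab
  obtain ⟨α, -, hα⟩ := EReal.lt_iff_exists_real_btwn.1 hx
  obtain ⟨β, -, hβ⟩ := EReal.lt_iff_exists_real_btwn.1 hy
  exact (EReal.bot_lt_coe _).trans_le (h x y a b α β ha hb hab hα.le hβ.le)

/-- Along rays. -/
lemma ConcE.ray {φ : E → EReal} (h : ConcE φ) (x₀ : E) (K ρ : ℝ) (hρ : 0 < ρ)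
    (h0 : (K : EReal) ≤ φ x₀) (h1 : ∀ x, ‖x - x₀‖ = ρ → φ x ≤ ((K - 1 : ℝ) : EReal))
    (x : E) (hx : ρ ≤ ‖x - x₀‖) : φ x ≤ ((K - ‖x - x₀‖ / ρ : ℝ) : EReal) := by
  by_contra hcon
  push Not at hcon
  obtain ⟨s, hs1, hs2⟩ := EReal.lt_iff_exists_real_btwn.1 hcon
  have hs1' : K - ‖x - x₀‖ / ρ < s := by exact_mod_cast hs1
  set R := ‖x - x₀‖ with hR
  have hRp : 0 < R := hρ.trans_le hx
  have := h x₀ x (1 - ρ / R) (ρ / R) K s (by rw [sub_nonneg, div_le_one hRp]; exact hx)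
    (by positivity) (by ring) h0 hs2.le
  have hle := this.trans (h1 _ ?_)
  · have hle' : (1 - ρ / R) * K + ρ / R * s ≤ K - 1 := by exact_mod_cast hle
    have : ρ / R * (K - R / ρ) < ρ / R * s := by
      apply mul_lt_mul_of_pos_left hs1'; positivity
    have e : ρ / R * (R / ρ) = 1 := by field_simp
    nlinarith
  · have : (1 - ρ / R) • x₀ + (ρ / R) • x - x₀ = (ρ / R) • (x - x₀) := by
      rw [sub_smul, smul_sub, one_smul]; abel
    rw [this, norm_smul, Real.norm_eq_abs, abs_of_pos (by positivity), ← hR]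
    field_simp

lemma ConcE.ray_bound {φ : E → EReal} (h : ConcE φ) (x₀ : E) (K ρ M : ℝ) (hρ : 0 < ρ)
    (h0 : (K : EReal) ≤ φ x₀) (h1 : ∀ x, ‖x - x₀‖ = ρ → φ x ≤ ((K - 1 : ℝ) : EReal))
    (hM : ∀ x, φ x ≤ M) (x : E) :
    φ x ≤ (((M + 1 + (1 / ρ) * ‖x₀‖) - (1 / ρ) * ‖x‖ : ℝ) : EReal) := by
  have hKM : K ≤ M := by exact_mod_cast h0.trans (hM x₀)
  have htri : ‖x‖ ≤ ‖x - x₀‖ + ‖x₀‖ := by simpa using norm_add_le (x - x₀) x₀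
  have htri' : 1 / ρ * ‖x‖ ≤ 1 / ρ * (‖x - x₀‖ + ‖x₀‖) := by gcongr
  rcases le_or_gt ρ ‖x - x₀‖ with hx | hx
  · refine (h.ray x₀ K ρ hρ h0 h1 x hx).trans ?_
    rw [EReal.coe_le_coe_iff]
    have : ‖x - x₀‖ / ρ = 1 / ρ * ‖x - x₀‖ := by ring
    rw [this]
    linarith
  · refine (hM x).trans ?_
    rw [EReal.coe_le_coe_iff]
    have : 1 / ρ * ‖x - x₀‖ ≤ 1 := by
      rw [one_div, inv_mul_le_iff₀ hρ]; linarith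
    linarith

end

lemma usc_bdd_ball {E : Type*} [NormedAddCommGroup E] [ProperSpace E] {φ : E → EReal}
    (hu : UpperSemicontinuous φ) (ht : ∀ x, φ x ≠ ⊤)
    (x₀ : E) (R : ℝ) (hR : 0 ≤ R) : ∃ M : ℝ, ∀ x ∈ Metric.closedBall x₀ R, φ x ≤ M := by
  obtain ⟨z, hz, hmax⟩ := (hu.upperSemicontinuousOn (Metric.closedBall x₀ R)).exists_isMaxOn
    (Metric.nonempty_closedBall.2 hR) (isCompact_closedBall x₀ R)
  obtain ⟨M, hM, -⟩ := EReal.lt_iff_exists_real_btwn.1 (lt_top_iff_ne_top.2 (ht z))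
  exact ⟨M, fun x hx => (hmax hx).trans hM.le⟩

lemma _root_.IsPhi.bound {E : Type*} [NormedAddCommGroup E] [NormedSpace ℝ E]
    [ProperSpace E] {φ : E → EReal} (h : IsPhi φ) :
    ∃ a b : ℝ, 0 < b ∧ ∀ x, φ x ≤ ((a - b * ‖x‖ : ℝ) : EReal) := by
  by_cases hb : ∀ x, φ x = ⊥
  · exact ⟨0, 1, one_pos, fun x => by rw [hb x]; exact bot_le⟩
  push Not at hb
  obtain ⟨z, hz⟩ := hb
  set m := (φ z).toReal with hm
  have hmz : (m : EReal) = φ z := EReal.coe_toReal (h.2.1 z) hz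
  have h4 := h.2.2.2
  rw [EReal.tendsto_nhds_bot_iff_real] at h4
  have h5 := h4 (m - 1)
  rw [Filter.eventually_comap, eventually_atTop] at h5
  obtain ⟨R, hR⟩ := h5
  set ρ := max (R + ‖z‖) 1
  have hρ : 0 < ρ := lt_max_of_lt_right one_pos
  have hfar : ∀ x, ρ ≤ ‖x - z‖ → φ x ≤ ((m - 1 : ℝ) : EReal) := by
    intro x hx
    refine (hR ‖x‖ ?_ x rfl).le
    have h1 : R + ‖z‖ ≤ ‖x - z‖ := (le_max_left _ _).trans hx
    have h2 := norm_sub_le x z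
    linarith
  obtain ⟨M, hM⟩ := usc_bdd_ball h.1 h.2.1 z ρ hρ.le
  have hM' : ∀ x, φ x ≤ ((max M (m - 1) : ℝ) : EReal) := by
    intro x
    rcases le_total ‖x - z‖ ρ with hx | hx
    · exact (hM x (by rwa [mem_closedBall_iff_norm])).trans
        (by exact_mod_cast le_max_left _ _)
    · exact (hfar x hx).trans (by exact_mod_cast le_max_right _ _)
  exact ⟨_, _, by positivity, h.conc.ray_bound z m ρ _ hρ hmz.le (fun x hx => hfar x hx.ge) hM'⟩

end LCD
namespace LCD
section
variable {E : Type*} [NormedAddCommGroup E] [InnerProductSpace ℝ E] [FiniteDimensional ℝ E]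

/-- Perturbing the vertices of a finite hull. -/
lemma hull_perturb {ι : Type*} [Finite ι] (p p' : ι → E) (x₀ : E) (R : ℝ) (hR : 0 < R)
    (hp : Metric.ball x₀ R ⊆ convexHull ℝ (range p)) (hpp : ∀ i, ‖p' i - p i‖ ≤ R / 4) :
    Metric.ball x₀ (R / 2) ⊆ convexHull ℝ (range p') := by
  intro y hy
  by_contra hcon
  have hcl : IsClosed (convexHull ℝ (range p')) := (Set.finite_range p').isClosed_convexHull ℝ
  obtain ⟨f, u, hfy, hfu⟩ := geometric_hahn_banach_point_closed (convex_convexHull ℝ _) hcl hcon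
  set v := (InnerProductSpace.toDual ℝ E).symm f with hv
  have hfv : ∀ x, f x = ⟪v, x⟫ := fun x => by
    rw [hv, InnerProductSpace.toDual_symm_apply]
  have hsub : convexHull ℝ (range p) ⊆ {x | f y - ‖v‖ * (R / 4) ≤ f x} := by
    apply convexHull_min
    · rintro _ ⟨i, rfl⟩
      have h1 := hfu (p' i) (subset_convexHull ℝ _ ⟨i, rfl⟩)
      have h2 : f (p' i) - f (p i) ≤ ‖v‖ * (R / 4) := by
        rw [← map_sub, hfv]
        exact (real_inner_le_norm _ _).trans (by gcongr; exact hpp i)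
      simp only [mem_ofPred_eq]
      linarith
    · exact convex_halfSpace_ge f.toLinearMap.isLinear _
  have hne : ∃ i : ι, True := by
    have := hp (Metric.mem_ball_self hR)
    by_contra h
    push Not at h
    have h0 : IsEmpty ι := ⟨fun i => (h i)⟩
    rw [range_eq_empty p] at this
    simp at this
  obtain ⟨i, -⟩ := hne
  have hv0 : v ≠ 0 := by
    intro h
    have h1 := hfu (p' i) (subset_convexHull ℝ _ ⟨i, rfl⟩)
    rw [hfv, h] at hfy
    rw [hfv, h] at h1
    simp at hfy h1
    linarith
  have hvp : 0 < ‖v‖ := norm_pos_iff.2 hv0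
  have hmem : y - (R / (3 * ‖v‖)) • v ∈ Metric.ball x₀ R := by
    rw [mem_ball_iff_norm] at hy ⊢
    have : y - (R / (3 * ‖v‖)) • v - x₀ = (y - x₀) - (R / (3 * ‖v‖)) • v := by abel
    rw [this]
    refine (norm_sub_le _ _).trans_lt ?_
    rw [norm_smul, Real.norm_eq_abs, abs_of_pos (by positivity)]
    have : R / (3 * ‖v‖) * ‖v‖ = R / 3 := by field_simp
    linarith
  have h3 := hsub (hp hmem)
  simp only [mem_ofPred_eq, map_sub, map_smul, smul_eq_mul] at h3
  rw [hfv v, real_inner_self_eq_norm_sq] at h3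
  have : R / (3 * ‖v‖) * ‖v‖ ^ 2 = ‖v‖ * (R / 3) := by field_simp
  rw [this] at h3
  nlinarith

lemma exists_simplex (x : E) (s : Set E) (hs : s ∈ 𝓝 x) :
    ∃ (n : ℕ) (p : Fin n → E) (R : ℝ), 0 < R ∧ Metric.ball x R ⊆ convexHull ℝ (range p) ∧
      ∀ i, p i ∈ s := by
  obtain ⟨b, hb1, hb2⟩ := exists_mem_interior_convexHull_affineBasis hs
  rw [mem_interior_iff_mem_nhds, Metric.mem_nhds_iff] at hb1
  obtain ⟨R, hR, hRb⟩ := hb1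
  exact ⟨_, b, R, hR, hRb, fun i => hb2 (subset_convexHull ℝ _ ⟨i, rfl⟩)⟩

lemma exists_finite_hull (x : E) (S : Set E) (hx : x ∈ interior (closure (convexHull ℝ S))) :
    ∃ (T : Finset E) (R : ℝ), 0 < R ∧ (T : Set E) ⊆ S ∧
      Metric.ball x R ⊆ convexHull ℝ (T : Set E) := by
  classical
  obtain ⟨n, p, R, hR, hball, hp⟩ := exists_simplex x _ (mem_interior_iff_mem_nhds.1 hx)
  have h1 : ∀ i, ∃ q ∈ convexHull ℝ S, ‖q - p i‖ ≤ R / 4 := by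
    intro i
    obtain ⟨q, hq, hd⟩ := Metric.mem_closure_iff.1 (hp i) (R / 4) (by positivity)
    exact ⟨q, hq, by rw [← dist_eq_norm, dist_comm]; exact hd.le⟩
  choose q hq hqd using h1
  have h2 : ∀ i, ∃ t : Finset E, (t : Set E) ⊆ S ∧ q i ∈ convexHull ℝ (t : Set E) := by
    intro i
    have := hq i
    rw [convexHull_eq_union_convexHull_finite_subsets] at this
    simpa using this
  choose t ht hqt using h2
  refine ⟨Finset.univ.biUnion t, R / 2, by positivity, ?_, ?_⟩
  · intro y hy
    simp at hy
    obtain ⟨i, hi⟩ := hy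
    exact ht i hi
  · refine (hull_perturb p q x R hR hball hqd).trans ?_
    apply convexHull_min _ (convex_convexHull ℝ _)
    rintro _ ⟨i, rfl⟩
    refine convexHull_mono ?_ (hqt i)
    intro y hy
    simp
    exact ⟨i, hy⟩

end

section
variable {E : Type*} [NormedAddCommGroup E]

/-- Hypograph convergence. -/
def Hypo (φn : ℕ → E → EReal) (φ : E → EReal) : Prop :=
  (∀ y, ∀ a, φ y < a → ∃ V ∈ 𝓝 y, ∀ᶠ n in atTop, ∀ x ∈ V, φn n x < a) ∧
  (∀ y, ∀ a, a < φ y → ∀ V ∈ 𝓝 y, ∀ᶠ n in atTop, ∃ x ∈ V, a < φn n x)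

lemma exists_hypo [SecondCountableTopology E] (φn : ℕ → E → EReal) :
    ∃ (k : ℕ → ℕ) (φ : E → EReal), StrictMono k ∧ UpperSemicontinuous φ ∧
      Hypo (fun j => φn (k j)) φ := by
  classical
  let B := TopologicalSpace.countableBasis E
  have hB : TopologicalSpace.IsTopologicalBasis B := TopologicalSpace.isBasis_countableBasis E
  have : Countable B := (TopologicalSpace.countable_countableBasis E).to_subtype
  let s : ℕ → B → EReal := fun n U => ⨆ x ∈ (U : Set E), φn n x
  obtain ⟨l, k, hk, hl⟩ := CompactSpace.tendsto_subseq s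
  have hl' : ∀ U : B, Tendsto (fun j => s (k j) U) atTop (𝓝 (l U)) := fun U =>
    (tendsto_pi_nhds.1 hl) U
  refine ⟨k, fun y => ⨅ U : B, ⨅ _ : y ∈ (U : Set E), l U, hk, ?_, ?_, ?_⟩
  · intro y a ha
    rw [iInf_lt_iff] at ha
    obtain ⟨U, hU⟩ := ha
    rw [iInf_lt_iff] at hU
    obtain ⟨hy, hU⟩ := hU
    filter_upwards [(hB.isOpen U.2).mem_nhds hy] with x hx
    exact (iInf₂_le U hx).trans_lt hU
  · intro y a ha
    rw [iInf_lt_iff] at ha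
    obtain ⟨U, hU⟩ := ha
    rw [iInf_lt_iff] at hU
    obtain ⟨hy, hU⟩ := hU
    refine ⟨U, (hB.isOpen U.2).mem_nhds hy, ?_⟩
    filter_upwards [(hl' U).eventually_lt_const hU] with n hn x hx
    exact (le_iSup₂ (f := fun x (_ : x ∈ (U : Set E)) => φn (k n) x) x hx).trans_lt hn
  · intro y a ha V hV
    obtain ⟨U, hU, hyU, hUV⟩ := hB.mem_nhds_iff.1 hV
    have h1 : a < l ⟨U, hU⟩ := ha.trans_le (iInf₂_le (⟨U, hU⟩ : B) hyU)
    filter_upwards [(hl' ⟨U, hU⟩).eventually_const_lt h1] with n hn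
    simp only [s, lt_iSup_iff] at hn
    obtain ⟨x, hx, hlt⟩ := hn
    exact ⟨x, hUV hx, hlt⟩

lemma Hypo.bound {φn : ℕ → E → EReal} {φ : E → EReal} (h : Hypo φn φ)
    (g : E → ℝ) (hg : Continuous g) (hb : ∀ n x, φn n x ≤ g x) (x : E) : φ x ≤ g x := by
  by_contra hcon
  push Not at hcon
  obtain ⟨s, hs1, hs2⟩ := EReal.lt_iff_exists_real_btwn.1 hcon
  have hs1' : g x < s := by exact_mod_cast hs1
  obtain ⟨n, y, hy, hn⟩ := (h.2 x s hs2 _ (hg.continuousAt.eventually_lt_const hs1')).exists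
  have : (s : EReal) < g y := hn.trans_le (hb n y)
  have : s < g y := by exact_mod_cast this
  simp only [mem_ofPred_eq] at hy
  linarith

lemma Hypo.tendsto_bot {φn : ℕ → E → EReal} {φ : E → EReal} (h : Hypo φn φ) (x : ℕ → E) (y : E)
    (hx : Tendsto x atTop (𝓝 y)) (a : EReal) (ha : φ y < a) :
    ∀ᶠ n in atTop, φn n (x n) < a := by
  obtain ⟨V, hV, h1⟩ := h.1 y a ha
  filter_upwards [h1, hx.eventually_mem hV] with n h1 h2 using h1 _ h2

end

section
variable {E : Type*} [NormedAddCommGroup E] [NormedSpace ℝ E]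

lemma Hypo.conc {φn : ℕ → E → EReal} {φ : E → EReal} (h : Hypo φn φ)
    (hc : ∀ n, ConcE (φn n)) : ConcE φ := by
  intro x y a b α β ha hb hab hα hβ
  by_contra hcon
  push Not at hcon
  obtain ⟨s, hs1, hs2⟩ := EReal.lt_iff_exists_real_btwn.1 hcon
  have hs2' : s < a * α + b * β := by exact_mod_cast hs2
  obtain ⟨V, hV, h1⟩ := h.1 _ s hs1
  set η := a * α + b * β - s with hη
  have hηp : 0 < η := by linarith
  have hcont : Continuous (fun p : E × E => a • p.1 + b • p.2) := by fun_prop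
  have h2 : (fun p : E × E => a • p.1 + b • p.2) ⁻¹' V ∈ 𝓝 (x, y) :=
    hcont.continuousAt.preimage_mem_nhds hV
  obtain ⟨V1, hV1, V2, hV2, h12⟩ := mem_nhds_prod_iff.1 h2
  have e1 := h.2 x ((α - η : ℝ) : EReal) (lt_of_lt_of_le (by exact_mod_cast sub_lt_self α hηp) hα) V1 hV1
  have e2 := h.2 y ((β - η : ℝ) : EReal) (lt_of_lt_of_le (by exact_mod_cast sub_lt_self β hηp) hβ) V2 hV2
  obtain ⟨n, ⟨⟨x', hx', hx''⟩, ⟨y', hy', hy''⟩⟩, hn⟩ := ((e1.and e2).and h1).exists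
  have h3 := hc n x' y' a b _ _ ha hb hab hx''.le hy''.le
  have h4 := h3.trans_lt (hn _ (h12 (mk_mem_prod hx' hy')))
  have h5 : a * (α - η) + b * (β - η) < s := by exact_mod_cast h4
  have : a * (α - η) + b * (β - η) = s := by
    have : a * (α - η) + b * (β - η) = a * α + b * β - (a + b) * η := by ring
    rw [this, hab, hη]; ring
  linarith

end

section
variable {E : Type*} [NormedAddCommGroup E] [InnerProductSpace ℝ E] [FiniteDimensional ℝ E]

lemma Hypo.interior_lower {φn : ℕ → E → EReal} {φ : E → EReal} (h : Hypo φn φ)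
    (hc : ∀ n, ConcE (φn n)) (y : E) (hy : y ∈ interior {x | ⊥ < φ x})
    (a : EReal) (ha : a < φ y) :
    ∃ V ∈ 𝓝 y, ∀ᶠ n in atTop, ∀ x ∈ V, a < φn n x := by
  have hφ := h.conc hc
  obtain ⟨b, hab, hb⟩ := EReal.lt_iff_exists_real_btwn.1 ha
  obtain ⟨c, hbc, hc'⟩ := EReal.lt_iff_exists_real_btwn.1 hb
  have hbc' : b < c := by exact_mod_cast hbc
  obtain ⟨n, p, R, hR, hball, hp⟩ := exists_simplex y _ (mem_interior_iff_mem_nhds.1 hy)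
  have h1 : ∀ i, ∃ m : ℝ, (m : EReal) ≤ φ (p i) := fun i => by
    obtain ⟨m, -, hm⟩ := EReal.lt_iff_exists_real_btwn.1 (hp i)
    exact ⟨m, hm.le⟩
  choose m hm using h1
  -- choose t small
  have h2 : ∀ᶠ t in 𝓝[>] (0 : ℝ), ∀ i, b < (1 - t) * c + t * m i := by
    rw [eventually_all]
    intro i
    have hcont : Continuous (fun t : ℝ => (1 - t) * c + t * m i) := by fun_prop
    have : ∀ᶠ t in 𝓝 (0 : ℝ), b < (1 - t) * c + t * m i :=
      hcont.continuousAt.eventually_const_lt (by simpa using hbc')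
    exact this.filter_mono nhdsWithin_le_nhds
  have h3 : ∀ᶠ t in 𝓝[>] (0 : ℝ), t ∈ Ioo (0 : ℝ) 1 := Ioo_mem_nhdsGT one_pos
  obtain ⟨t, ht, ht0, ht1⟩ := (h2.and h3).exists
  set p' : Fin n → E := fun i => (1 - t) • y + t • p i with hp'
  have hφp : ∀ i, (b : EReal) < φ (p' i) := by
    intro i
    have := hφ y (p i) (1 - t) t c (m i) (by linarith) ht0.le (by ring) hc'.le (hm i)
    exact lt_of_lt_of_le (by exact_mod_cast ht i) this
  have hball' : Metric.ball y (t * R) ⊆ convexHull ℝ (range p') := by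
    intro z hz
    have hz' : y + t⁻¹ • (z - y) ∈ Metric.ball y R := by
      rw [mem_ball_iff_norm] at hz ⊢
      rw [add_sub_cancel_left, norm_smul, Real.norm_eq_abs, abs_of_pos (by positivity),
        inv_mul_lt_iff₀ ht0]
      exact hz
    have h5 := hball hz'
    let F : E →ᵃ[ℝ] E := AffineMap.homothety y t
    have hF : ∀ x, F x = (1 - t) • y + t • x := by
      intro x
      simp only [F, AffineMap.homothety_apply, vsub_eq_sub, vadd_eq_add, sub_smul, smul_sub,
        one_smul]
      abel
    have h6 : range p' = F '' range p := by
      rw [← range_comp]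
      congr 1
      ext1 i
      simp [hF, hp']
    rw [h6, ← AffineMap.image_convexHull]
    refine ⟨_, h5, ?_⟩
    rw [hF, smul_add, smul_smul, mul_inv_cancel₀ ht0.ne', sub_smul, one_smul, one_smul]
    abel
  have hRt : 0 < t * R := by positivity
  have ev : ∀ᶠ k in atTop, ∀ i, ∃ x ∈ Metric.closedBall (p' i) (t * R / 4), (b : EReal) < φn k x := by
    rw [eventually_all]
    intro i
    exact h.2 (p' i) b (hφp i) _ (Metric.closedBall_mem_nhds _ (by positivity))
  refine ⟨Metric.ball y (t * R / 2), Metric.ball_mem_nhds _ (by positivity), ?_⟩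
  filter_upwards [ev] with k hk x hx
  choose q hq hqb using hk
  have h7 := hull_perturb p' q y (t * R) hRt hball' (fun i => by
    simpa [dist_eq_norm] using hq i) hx
  refine hab.trans_le ?_
  refine convexHull_min ?_ ((hc k).convex_level b) h7
  rintro _ ⟨i, rfl⟩
  exact (hqb i).le

lemma Hypo.tendsto {φn : ℕ → E → EReal} {φ : E → EReal} (h : Hypo φn φ)
    (hc : ∀ n, ConcE (φn n)) (y : E) (hy : y ∉ frontier {x | ⊥ < φ x})
    (x : ℕ → E) (hx : Tendsto x atTop (𝓝 y)) :
    Tendsto (fun n => φn n (x n)) atTop (𝓝 (φ y)) := by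
  rw [tendsto_order]
  refine ⟨fun a ha => ?_, fun a ha => h.tendsto_bot x y hx a ha⟩
  have hy' : y ∈ interior {x | ⊥ < φ x} := by
    have h1 : y ∈ {x | ⊥ < φ x} := bot_le.trans_lt ha
    by_contra hcon
    exact hy ⟨subset_closure h1, hcon⟩
  obtain ⟨V, hV, h1⟩ := h.interior_lower hc y hy' a ha
  filter_upwards [h1, hx.eventually_mem hV] with n h1 h2 using h1 _ h2

end
end LCD
namespace LCD
set_option linter.unusedSectionVars false
section
variable {E : Type*} [NormedAddCommGroup E] [MeasurableSpace E] [BorelSpace E]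
  [SecondCountableTopology E]

lemma integrable_norm_of (Q : Measure E) (hQ : (∫⁻ x, (‖x‖₊ : ℝ≥0∞) ∂Q) ≠ ⊤) :
    Integrable (fun x : E => x) Q :=
  ⟨aestronglyMeasurable_id, lt_top_iff_ne_top.2 hQ⟩

lemma integrable_lip (Q : Measure E) [IsProbabilityMeasure Q]
    (hQ : (∫⁻ x, (‖x‖₊ : ℝ≥0∞) ∂Q) ≠ ⊤) (K : NNReal) (g : E → ℝ) (hg : LipschitzWith K g) :
    Integrable g Q := by
  have h1 : Integrable (fun x : E => |g 0| + K * ‖x‖) Q :=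
    (integrable_const _).add ((integrable_norm_of Q hQ).norm.const_mul _)
  refine h1.mono' hg.continuous.aestronglyMeasurable (ae_of_all _ fun x => ?_)
  have h2 := hg.dist_le_mul x 0
  rw [dist_eq_norm, dist_eq_norm, sub_zero] at h2
  have h3 := abs_sub_abs_le_abs_sub (g x) (g 0)
  rw [Real.norm_eq_abs] at *
  linarith

lemma D1_bdd (Q Q' : Measure E) [IsProbabilityMeasure Q] [IsProbabilityMeasure Q']
    (hQ : (∫⁻ x, (‖x‖₊ : ℝ≥0∞) ∂Q) ≠ ⊤) (hQ' : (∫⁻ x, (‖x‖₊ : ℝ≥0∞) ∂Q') ≠ ⊤) :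
    BddAbove {r : ℝ | ∃ h : E → ℝ, LipschitzWith 1 h ∧
      r = |(∫ x, h x ∂Q) - ∫ x, h x ∂Q'|} := by
  refine ⟨∫ x, ‖x‖ ∂Q + ∫ x, ‖x‖ ∂Q', ?_⟩
  rintro _ ⟨h, hh, rfl⟩
  have key : ∀ (P : Measure E) [IsProbabilityMeasure P],
      (∫⁻ x, (‖x‖₊ : ℝ≥0∞) ∂P) ≠ ⊤ → |(∫ x, h x ∂P) - h 0| ≤ ∫ x, ‖x‖ ∂P := by
    intro P _ hP
    have e : (∫ x, h x ∂P) - h 0 = ∫ x, (h x - h 0) ∂P := by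
      rw [integral_sub (integrable_lip P hP 1 h hh) (integrable_const _)]
      simp
    rw [e, ← Real.norm_eq_abs]
    refine norm_integral_le_of_norm_le (integrable_norm_of P hP).norm (ae_of_all _ fun x => ?_)
    have h2 := hh.dist_le_mul x 0
    rw [dist_eq_norm, dist_eq_norm, sub_zero] at h2
    simpa using h2
  have h1 := key Q hQ
  have h2 := key Q' hQ'
  rw [abs_le] at *
  constructor <;> linarith [h1.1, h1.2, h2.1, h2.2]

lemma D1_nonneg (Q Q' : Measure E) : 0 ≤ D1 Q Q' := by
  apply Real.sSup_nonneg
  rintro _ ⟨h, -, rfl⟩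
  exact abs_nonneg _

lemma D1_lip (Q Q' : Measure E) [IsProbabilityMeasure Q] [IsProbabilityMeasure Q']
    (hQ : (∫⁻ x, (‖x‖₊ : ℝ≥0∞) ∂Q) ≠ ⊤) (hQ' : (∫⁻ x, (‖x‖₊ : ℝ≥0∞) ∂Q') ≠ ⊤)
    (K : ℝ) (hK : 0 < K) (g : E → ℝ) (hg : ∀ x y, |g x - g y| ≤ K * ‖x - y‖) :
    |(∫ x, g x ∂Q) - ∫ x, g x ∂Q'| ≤ K * D1 Q Q' := by
  have h1 : |(∫ x, K⁻¹ * g x ∂Q) - ∫ x, K⁻¹ * g x ∂Q'| ≤ D1 Q Q' := by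
    refine le_csSup (D1_bdd Q Q' hQ hQ') ⟨fun x => K⁻¹ * g x, ?_, rfl⟩
    refine LipschitzWith.of_dist_le_mul fun x y => ?_
    rw [dist_eq_norm, dist_eq_norm, Real.norm_eq_abs, ← mul_sub, abs_mul,
      abs_of_pos (inv_pos.2 hK), inv_mul_le_iff₀ hK]
    simpa using hg x y
  rw [integral_const_mul, integral_const_mul, ← mul_sub, abs_mul, abs_of_pos (inv_pos.2 hK),
    inv_mul_le_iff₀ hK] at h1
  exact h1

end

section
variable {E : Type*} [NormedAddCommGroup E] [InnerProductSpace ℝ E] [FiniteDimensional ℝ E]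
  [MeasurableSpace E] [BorelSpace E]

/-- Convex sets of large `Q`-measure contain a fixed ball. -/
def Good (Q : Measure E) (x₀ : E) (r q : ℝ) : Prop :=
  ∀ D : Set E, Convex ℝ D → Q Dᶜ < ENNReal.ofReal q → Metric.ball x₀ r ⊆ D

lemma csupp_eq (Q : Measure E) [IsProbabilityMeasure Q] :
    csupp Q = closure (convexHull ℝ Q.support) := by
  apply subset_antisymm
  · apply sInter_subset_of_mem
    refine ⟨isClosed_closure, (convex_convexHull ℝ _).closure, ?_⟩
    have h1 : Q Q.support = 1 := by
      rw [prob_compl_eq_zero_iff Measure.isClosed_support.measurableSet |>.1]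
      exact Measure.measure_compl_support
    refine le_antisymm prob_le_one ?_
    rw [← h1]
    exact measure_mono ((subset_convexHull ℝ _).trans subset_closure)
  · apply subset_sInter
    rintro C ⟨hC, hconv, hC1⟩
    apply closure_minimal _ hC
    apply convexHull_min _ hconv
    apply Measure.support_subset_of_isClosed hC
    rw [mem_ae_iff]
    exact (prob_compl_eq_zero_iff hC.measurableSet).2 hC1

lemma csupp_full (Q : Measure E) [IsProbabilityMeasure Q] : Q (csupp Q)ᶜ = 0 := by
  rw [csupp_eq]
  refine measure_mono_null ?_ (Measure.measure_compl_support (μ := Q))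
  exact compl_subset_compl.2 ((subset_convexHull ℝ _).trans subset_closure)

lemma exists_good (Qn : ℕ → Measure E) (Q : Measure E)
    [∀ n, IsProbabilityMeasure (Qn n)] [IsProbabilityMeasure Q]
    (hQn : ∀ n, (∫⁻ x, (‖x‖₊ : ℝ≥0∞) ∂(Qn n)) ≠ ⊤)
    (hQ : (∫⁻ x, (‖x‖₊ : ℝ≥0∞) ∂Q) ≠ ⊤)
    (hD : Tendsto (fun n => D1 (Qn n) Q) atTop (𝓝 0)) (x₀ : E) (hx : x₀ ∈ interior (csupp Q)) :
    ∃ r > 0, ∃ q > 0, ∀ᶠ n in atTop, Good (Qn n) x₀ r q := by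
  rw [csupp_eq] at hx
  obtain ⟨T, R, hR, hT, hball⟩ := exists_finite_hull x₀ _ hx
  set δ := R / 4 with hδ
  have hδp : 0 < δ := by positivity
  let h : E → E → ℝ := fun p x => max (δ - ‖x - p‖) 0
  have hlip : ∀ p x y, |h p x - h p y| ≤ 1 * ‖x - y‖ := by
    intro p x y
    rw [one_mul]
    refine (abs_max_sub_max_le_abs _ _ _).trans ?_
    have : δ - ‖x - p‖ - (δ - ‖y - p‖) = ‖y - p‖ - ‖x - p‖ := by ring
    rw [this]
    refine (abs_norm_sub_norm_le _ _).trans ?_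
    rw [sub_sub_sub_cancel_right, norm_sub_rev]
  have hNE : ∀ p (P : Measure E) [IsProbabilityMeasure P],
      (∫⁻ x, (‖x‖₊ : ℝ≥0∞) ∂P) ≠ ⊤ → Integrable (h p) P := by
    intro p P _ hP
    refine integrable_lip P hP 1 _ (LipschitzWith.of_dist_le_mul fun x y => ?_)
    rw [dist_eq_norm, dist_eq_norm, Real.norm_eq_abs]
    exact hlip p x y
  have hnn : ∀ p x, 0 ≤ h p x := fun p x => le_max_right _ _
  have hpos : ∀ p ∈ T, 0 < ∫ x, h p x ∂Q := by
    intro p hp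
    rw [integral_pos_iff_support_of_nonneg (hnn p) (hNE p Q hQ)]
    have : Metric.ball p δ ⊆ Function.support (h p) := by
      intro x hx
      rw [mem_ball_iff_norm] at hx
      have : 0 < h p x := lt_max_of_lt_left (by linarith)
      exact this.ne'
    refine lt_of_lt_of_le ?_ (measure_mono this)
    exact (Measure.mem_support_iff_forall p).1 (hT hp) _ (Metric.ball_mem_nhds p hδp)
  have hup : ∀ p (P : Measure E) [IsProbabilityMeasure P],
      (∫⁻ x, (‖x‖₊ : ℝ≥0∞) ∂P) ≠ ⊤ → ∫ x, h p x ∂P ≤ δ * P.real (Metric.ball p δ) := by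
    intro p P _ hP
    have : ∫ x, h p x ∂P ≤ ∫ x, (Metric.ball p δ).indicator (fun _ => δ) x ∂P := by
      refine integral_mono (hNE p P hP) ((integrable_const δ).indicator measurableSet_ball) ?_
      intro x
      by_cases hx : x ∈ Metric.ball p δ
      · rw [indicator_of_mem hx]
        exact max_le (by linarith [norm_nonneg (x - p)]) hδp.le
      · rw [indicator_of_notMem hx]
        rw [mem_ball_iff_norm, not_lt] at hx
        exact max_le (by linarith) le_rfl
    refine this.trans_eq ?_
    rw [integral_indicator measurableSet_ball, setIntegral_const, smul_eq_mul, mul_comm]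
  have h3 : ∀ᶠ q in 𝓝[>] (0 : ℝ), ∀ p ∈ T, q * δ < (∫ x, h p x ∂Q) / 2 := by
    rw [Filter.eventually_all_finset]
    intro p hp
    have hcont : Continuous (fun q : ℝ => q * δ) := by fun_prop
    have : ∀ᶠ q in 𝓝 (0 : ℝ), q * δ < (∫ x, h p x ∂Q) / 2 :=
      hcont.continuousAt.eventually_lt_const (by simpa using hpos p hp)
    exact this.filter_mono nhdsWithin_le_nhds
  obtain ⟨q, hq, hq0⟩ := (h3.and self_mem_nhdsWithin).exists
  refine ⟨R / 2, by positivity, q, hq0, ?_⟩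
  have h4 : ∀ᶠ n in atTop, ∀ p ∈ T, D1 (Qn n) Q < (∫ x, h p x ∂Q) / 2 := by
    rw [Filter.eventually_all_finset]
    intro p hp
    exact hD.eventually_lt_const (half_pos (hpos p hp))
  filter_upwards [h4] with n hn D hDc hDq
  have h5 : ∀ p : T, ∃ y ∈ D, ‖y - p‖ ≤ R / 4 := by
    rintro ⟨p, hp⟩
    by_contra hcon
    push Not at hcon
    have hsub : Metric.ball p δ ⊆ Dᶜ := by
      intro y hy hyD
      rw [mem_ball_iff_norm] at hy
      have := hcon y hyD
      simp only at this
      linarith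
    have h6 := (measure_mono hsub).trans_lt hDq
    have h7 : (Qn n).real (Metric.ball p δ) < q := by
      rw [Measure.real, ← ENNReal.toReal_ofReal (le_of_lt hq0)]
      exact (ENNReal.toReal_lt_toReal (measure_ne_top _ _) ENNReal.ofReal_ne_top).2 h6
    have h8 := hup p (Qn n) (hQn n)
    have h9 := D1_lip (Qn n) Q (hQn n) hQ 1 one_pos (h p) (hlip p)
    have h10 := hn p hp
    have h11 := hq p hp
    rw [abs_le] at h9
    nlinarith [h9.1]
  choose y hyD hy using h5
  have h6 := hull_perturb (fun p : T => (p : E)) y x₀ R hR (by simpa using hball) hy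
  refine h6.trans (convexHull_min ?_ hDc)
  rintro _ ⟨i, rfl⟩
  exact hyD i

lemma Good.csupp {Q : Measure E} [IsProbabilityMeasure Q] {x₀ : E} {r q : ℝ} (hr : 0 < r)
    (hq : 0 < q) (h : Good Q x₀ r q) : x₀ ∈ interior (csupp Q) := by
  rw [mem_interior]
  refine ⟨Metric.ball x₀ r, ?_, Metric.isOpen_ball, Metric.mem_ball_self hr⟩
  apply subset_sInter
  rintro C ⟨hC, hconv, hC1⟩
  apply h C hconv
  rw [(prob_compl_eq_zero_iff hC.measurableSet).2 hC1]
  simpa using hq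

end

section
variable {E : Type*} [NormedAddCommGroup E] [NormedSpace ℝ E]

/-- Lipschitz regularisation (sup-convolution). -/
noncomputable def supc (k : ℝ) (φ : E → EReal) (x : E) : ℝ :=
  ⨆ y : {y : E // φ y ≠ ⊥}, ((φ y).toReal - k * ‖x - y‖)

variable {φ : E → EReal} {k M : ℝ}

lemma ne_top_of (hM : ∀ x, φ x ≤ M)
    (x : E) : φ x ≠ ⊤ := ((hM x).trans_lt (EReal.coe_lt_top _)).ne

lemma supc_bdd (hM : ∀ x, φ x ≤ M) (hk : 0 ≤ k)
    (x : E) :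
    BddAbove (range fun y : {y : E // φ y ≠ ⊥} => ((φ y).toReal - k * ‖x - y‖)) := by
  refine ⟨M, ?_⟩
  rintro _ ⟨y, rfl⟩
  have h1 : (φ y).toReal ≤ M := by
    rw [← EReal.coe_le_coe_iff, EReal.coe_toReal (ne_top_of hM _) y.2]
    exact hM y
  have : 0 ≤ k * ‖x - y‖ := by positivity
  simp only
  linarith

lemma le_supc (hM : ∀ x, φ x ≤ M) (hk : 0 ≤ k)
    (x y : E) (hy : φ y ≠ ⊥) : (φ y).toReal - k * ‖x - y‖ ≤ supc k φ x :=
  le_ciSup (supc_bdd hM hk x) (⟨y, hy⟩ : {y : E // φ y ≠ ⊥})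

lemma le_supc' (hM : ∀ x, φ x ≤ M) (hk : 0 ≤ k)
    (x : E) : φ x ≤ supc k φ x := by
  by_cases hx : φ x = ⊥
  · rw [hx]; exact bot_le
  have := le_supc hM hk x x hx
  rw [sub_self, norm_zero, mul_zero, sub_zero] at this
  rw [← EReal.coe_toReal (ne_top_of hM _) hx]
  exact_mod_cast this

lemma supc_le (hne : ∃ z, φ z ≠ ⊥)
    (x : E) (B : ℝ) (h : ∀ y, φ y ≠ ⊥ → (φ y).toReal - k * ‖x - y‖ ≤ B) :
    supc k φ x ≤ B := by
  obtain ⟨z, hz⟩ := hne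
  have : Nonempty {y : E // φ y ≠ ⊥} := ⟨⟨z, hz⟩⟩
  exact ciSup_le fun y => h y y.2

lemma supc_le_M (hM : ∀ x, φ x ≤ M) (hk : 0 ≤ k) (hne : ∃ z, φ z ≠ ⊥)
    (x : E) : supc k φ x ≤ M := by
  apply supc_le hne
  intro y hy
  have h1 : (φ y).toReal ≤ M := by
    rw [← EReal.coe_le_coe_iff, EReal.coe_toReal (ne_top_of hM _) hy]
    exact hM y
  have : 0 ≤ k * ‖x - y‖ := by positivity
  linarith

lemma supc_lip (hM : ∀ x, φ x ≤ M) (hk : 0 ≤ k) (hne : ∃ z, φ z ≠ ⊥)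
    (x x' : E) : |supc k φ x - supc k φ x'| ≤ k * ‖x - x'‖ := by
  have key : ∀ x x', supc k φ x ≤ supc k φ x' + k * ‖x - x'‖ := by
    intro x x'
    apply supc_le hne
    intro y hy
    have h1 := le_supc hM hk x' y hy
    have h2 : ‖x' - y‖ ≤ ‖x - x'‖ + ‖x - y‖ := by
      have := norm_sub_le (x - y) (x - x')
      rw [sub_sub_sub_cancel_left] at this
      linarith
    have := mul_le_mul_of_nonneg_left h2 hk
    linarith
  rw [abs_le]
  have h1 := key x x'
  have h2 := key x' x
  rw [norm_sub_rev] at h2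
  constructor <;> linarith

lemma supc_lipschitz (hM : ∀ x, φ x ≤ M) (hk : 0 ≤ k) (hne : ∃ z, φ z ≠ ⊥)
    : LipschitzWith k.toNNReal (supc k φ) := by
  refine LipschitzWith.of_dist_le_mul fun x y => ?_
  rw [dist_eq_norm, dist_eq_norm, Real.norm_eq_abs, Real.coe_toNNReal _ hk]
  exact supc_lip hM hk hne x y

lemma supc_conc (hM : ∀ x, φ x ≤ M) (hk : 0 ≤ k) (hne : ∃ z, φ z ≠ ⊥)
    (hc : ConcE φ) : ConcE (fun x => (supc k φ x : EReal)) := by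
  intro x y a b α β ha hb hab hα hβ
  have hα' : α ≤ supc k φ x := EReal.coe_le_coe_iff.1 hα
  have hβ' : β ≤ supc k φ y := EReal.coe_le_coe_iff.1 hβ
  rw [EReal.coe_le_coe_iff]
  have : Nonempty {y : E // φ y ≠ ⊥} := by
    obtain ⟨z, hz⟩ := hne
    exact ⟨⟨z, hz⟩⟩
  refine le_of_forall_pos_lt_add fun ε hε => ?_
  obtain ⟨⟨u, hu⟩, hu'⟩ := exists_lt_of_lt_ciSup (f := fun z : {y : E // φ y ≠ ⊥} => ((φ z).toReal - k * ‖x - z‖))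
    (show α - ε / 2 < _ from (by linarith : α - ε / 2 < α).trans_le hα')
  obtain ⟨⟨v, hv⟩, hv'⟩ := exists_lt_of_lt_ciSup (f := fun z : {y : E // φ y ≠ ⊥} => ((φ z).toReal - k * ‖y - z‖))
    (show β - ε / 2 < _ from (by linarith : β - ε / 2 < β).trans_le hβ')
  simp only at hu' hv'
  have h1 := hc u v a b (φ u).toReal (φ v).toReal ha hb hab
    (by rw [EReal.coe_toReal (ne_top_of hM _) hu]) (by rw [EReal.coe_toReal (ne_top_of hM _) hv])
  have hw : φ (a • u + b • v) ≠ ⊥ := ((EReal.bot_lt_coe _).trans_le h1).ne'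
  have h2 := le_supc hM hk (a • x + b • y) (a • u + b • v) hw
  have h1' : a * (φ u).toReal + b * (φ v).toReal ≤ (φ (a • u + b • v)).toReal := by
    rw [← EReal.coe_le_coe_iff, EReal.coe_toReal (ne_top_of hM _) hw]
    exact h1
  have h3 : ‖a • x + b • y - (a • u + b • v)‖ ≤ a * ‖x - u‖ + b * ‖y - v‖ := by
    have : a • x + b • y - (a • u + b • v) = a • (x - u) + b • (y - v) := by
      rw [smul_sub, smul_sub]; abel
    rw [this]
    refine (norm_add_le _ _).trans ?_
    rw [norm_smul, norm_smul, Real.norm_eq_abs, Real.norm_eq_abs, abs_of_nonneg ha,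
      abs_of_nonneg hb]
  have h4 := mul_le_mul_of_nonneg_left h3 hk
  have h5 := mul_le_mul_of_nonneg_left hu'.le ha
  have h6 := mul_le_mul_of_nonneg_left hv'.le hb
  have h7 : a * (ε / 2) + b * (ε / 2) = ε / 2 := by rw [← add_mul, hab, one_mul]
  nlinarith

lemma supc_bound (hne : ∃ z, φ z ≠ ⊥)
    (a b : ℝ) (hb : 0 ≤ b) (hbk : b ≤ k)
    (hab : ∀ x, φ x ≤ ((a - b * ‖x‖ : ℝ) : EReal)) (x : E) : supc k φ x ≤ a - b * ‖x‖ := by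
  apply supc_le hne
  intro y hy
  have ht : φ y ≠ ⊤ := ((hab y).trans_lt (EReal.coe_lt_top _)).ne
  have h1 : (φ y).toReal ≤ a - b * ‖y‖ := by
    rw [← EReal.coe_le_coe_iff, EReal.coe_toReal ht hy]
    exact hab y
  have h2 : ‖x‖ ≤ ‖x - y‖ + ‖y‖ := by simpa using norm_add_le (x - y) y
  have h3 : b * ‖x - y‖ ≤ k * ‖x - y‖ := by gcongr
  have h4 := mul_le_mul_of_nonneg_left h2 hb
  linarith

lemma supc_local (hM : ∀ x, φ x ≤ M) (hk : 0 ≤ k) (hne : ∃ z, φ z ≠ ⊥)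
    (x : E) (δ α : ℝ) (h1 : ∀ y, ‖x - y‖ < δ → φ y ≤ α) (h2 : M - k * δ ≤ α) :
    supc k φ x ≤ α := by
  apply supc_le hne
  intro y hy
  rcases lt_or_ge ‖x - y‖ δ with h | h
  · have : (φ y).toReal ≤ α := by
      rw [← EReal.coe_le_coe_iff, EReal.coe_toReal (ne_top_of hM _) hy]
      exact h1 y h
    have : 0 ≤ k * ‖x - y‖ := by positivity
    linarith
  · have h1 : (φ y).toReal ≤ M := by
      rw [← EReal.coe_le_coe_iff, EReal.coe_toReal (ne_top_of hM _) hy]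
      exact hM y
    have := mul_le_mul_of_nonneg_left h hk
    linarith

end
end LCD
namespace LCD
set_option linter.unusedSectionVars false
section
variable {E : Type*} [NormedAddCommGroup E] [InnerProductSpace ℝ E] [FiniteDimensional ℝ E]
  [MeasureSpace E] [BorelSpace E] [(volume : Measure E).IsAddHaarMeasure]

lemma phi_max {φ : E → EReal} (h : IsPhi φ) (hne : ∃ z, φ z ≠ ⊥) :
    ∃ z, φ z ≠ ⊥ ∧ ∀ x, φ x ≤ φ z := by
  have : ProperSpace E := FiniteDimensional.proper ℝ E
  obtain ⟨a, b, hb, hab⟩ := h.bound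
  obtain ⟨z₀, hz₀⟩ := hne
  set m := (φ z₀).toReal with hm
  have hmz : (m : EReal) = φ z₀ := EReal.coe_toReal (h.2.1 z₀) hz₀
  set ρ := max ‖z₀‖ ((a - m) / b) with hρ
  have hz₀m : z₀ ∈ Metric.closedBall (0 : E) ρ := by
    rw [mem_closedBall_zero_iff]; exact le_max_left _ _
  obtain ⟨z, hz, hmax⟩ := (h.1.upperSemicontinuousOn (Metric.closedBall 0 ρ)).exists_isMaxOn
    ⟨z₀, hz₀m⟩ (isCompact_closedBall (0 : E) ρ)
  have h0 : φ z₀ ≤ φ z := hmax hz₀m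
  refine ⟨z, ((bot_lt_iff_ne_bot.2 hz₀).trans_le h0).ne', fun x => ?_⟩
  by_cases hx : x ∈ Metric.closedBall (0 : E) ρ
  · exact hmax hx
  · rw [mem_closedBall_zero_iff, not_le] at hx
    refine (hab x).trans (le_trans ?_ h0)
    rw [← hmz, EReal.coe_le_coe_iff]
    have : (a - m) / b < ‖x‖ := (le_max_right _ _).trans_lt hx
    rw [div_lt_iff₀ hb] at this
    linarith

lemma ne_bot_of_Lfun {φ : E → EReal} {Q : Measure E} [IsProbabilityMeasure Q] {c : ℝ}
    (h : IsPhi φ) (hc : (c : EReal) ≤ Lfun φ Q) : ∃ z, φ z ≠ ⊥ := by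
  by_contra hcon
  push Not at hcon
  have h1 := ((le_Lfun_iff' Q 0 φ h.1.measurable (fun x => by rw [hcon x]; exact bot_le) c).1 hc).2
  have : Vf 0 φ Q = ⊤ := by
    unfold Vf
    simp [hcon]
  rw [this] at h1
  exact absurd h1 (by simp)

lemma good_level {φ : E → EReal} {Q : Measure E} (hφ : Measurable φ)
    (hc : ConcE φ) {x₀ : E} {r q : ℝ} (hg : Good Q x₀ r q) (M s I : ℝ)
    (hI : 0 ≤ I) (hV : Vf M φ Q ≤ ENNReal.ofReal I) (hs : s ≤ M) (hlt : I < (M - s) * q) :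
    ∀ x ∈ Metric.ball x₀ r, (s : EReal) ≤ φ x := by
  refine hg {x | (s : EReal) ≤ φ x} (hc.convex_level s) ?_
  by_contra hcon
  push Not at hcon
  have h1 : ENNReal.ofReal (M - s) * Q {x | ENNReal.ofReal (M - s) ≤ ((M : EReal) - φ x).toENNReal}
      ≤ ∫⁻ x, ((M : EReal) - φ x).toENNReal ∂Q := by
    apply mul_meas_ge_le_lintegral₀
    fun_prop
  have h2 : {x | (s : EReal) ≤ φ x}ᶜ ⊆ {x | ENNReal.ofReal (M - s) ≤ ((M : EReal) - φ x).toENNReal} := by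
    intro x hx
    have hx' : φ x < s := not_le.1 hx
    have : ((M - s : ℝ) : EReal) ≤ (M : EReal) - φ x := by
      rw [EReal.coe_sub]
      exact EReal.sub_le_sub le_rfl hx'.le
    have := EReal.toENNReal_le_toENNReal this
    rw [EReal.toENNReal_of_ne_top (EReal.coe_ne_top _), EReal.toReal_coe] at this
    exact this
  have h3 : ENNReal.ofReal ((M - s) * q) ≤ ENNReal.ofReal I := by
    rw [ENNReal.ofReal_mul (by linarith)]
    refine le_trans ?_ hV
    refine le_trans ?_ (le_self_add : _ ≤ Vf M φ Q)
    refine le_trans ?_ h1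
    gcongr
    exact hcon.trans (measure_mono h2)
  rw [ENNReal.ofReal_le_ofReal_iff hI] at h3
  linarith

lemma vol_lower {φ : E → EReal} {Q : Measure E} (hφ : Measurable φ)
    (M s I : ℝ) (hI : 0 ≤ I) (hV : Vf M φ Q ≤ ENNReal.ofReal I) (S : Set E)
    (hS : volume S ≠ ⊤) (hsS : ∀ x ∈ S, (s : EReal) ≤ φ x) :
    Real.exp s * volume.real S ≤ I := by
  have h1 : ENNReal.ofReal (Real.exp s) * volume {x | ENNReal.ofReal (Real.exp s) ≤ EReal.exp (φ x)}
      ≤ ∫⁻ x, EReal.exp (φ x) := by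
    apply mul_meas_ge_le_lintegral₀
    exact (EReal.measurable_exp.comp hφ).aemeasurable
  have h2 : S ⊆ {x | ENNReal.ofReal (Real.exp s) ≤ EReal.exp (φ x)} := by
    intro x hx
    have := EReal.exp_monotone (hsS x hx)
    simpa using this
  rw [← ENNReal.ofReal_le_ofReal_iff hI]
  rw [ENNReal.ofReal_mul (Real.exp_pos _).le, Measure.real, ENNReal.ofReal_toReal hS]
  refine le_trans ?_ hV
  refine le_trans ?_ (le_add_self : _ ≤ Vf M φ Q)
  refine le_trans ?_ h1
  gcongr

lemma real_ball_pos (y : E) (ρ : ℝ) (hρ : 0 < ρ) : 0 < volume.real (Metric.ball y ρ) := by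
  have : ProperSpace E := FiniteDimensional.proper ℝ E
  exact ENNReal.toReal_pos (Metric.measure_ball_pos volume y hρ).ne' measure_ball_lt_top.ne

lemma real_ball_eq (y : E) (ρ : ℝ) :
    volume.real (Metric.ball y ρ) = volume.real (Metric.ball (0 : E) ρ) := by
  rw [Measure.real, Measure.real, Measure.addHaar_ball_center]

lemma apriori_max (x₀ : E) (r q c : ℝ) (hr : 0 < r) (hq : 0 < q) :
    ∃ M : ℝ, ∀ (Q : Measure E) [IsProbabilityMeasure Q] (φ : E → EReal), IsPhi φ →
      Good Q x₀ r q → (c : EReal) ≤ Lfun φ Q → ∀ x, φ x ≤ M := by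
  have : ProperSpace E := FiniteDimensional.proper ℝ E
  set κ := 2 / q with hκ
  have hκp : 0 < κ := by positivity
  set l := 1 / (2 * (1 + κ)) with hl
  have hlp : 0 < l := by positivity
  have hl1 : l * (1 + κ) = 1 / 2 := by rw [hl]; field_simp
  have hl1' : l ≤ 1 := by nlinarith
  set v := volume.real (Metric.ball (0 : E) (l * r)) with hv
  have hvp : 0 < v := real_ball_pos _ _ (by positivity)
  refine ⟨max 1 (max (1 - c) (8 * (2 + |c|) / v)), ?_⟩
  intro Q _ φ hφ hg hc x
  obtain ⟨z, hz, hmax⟩ := phi_max hφ (ne_bot_of_Lfun hφ hc)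
  set M := (φ z).toReal with hM
  have hMz : (M : EReal) = φ z := EReal.coe_toReal (hφ.2.1 z) hz
  refine (hmax x).trans ?_
  rw [← hMz, EReal.coe_le_coe_iff]
  by_contra hcon
  push Not at hcon
  rw [max_lt_iff, max_lt_iff] at hcon
  obtain ⟨hM1, hMc, hMv⟩ := hcon
  have hbd : ∀ x, φ x ≤ M := fun x => by rw [hMz]; exact hmax x
  obtain ⟨hI, hV⟩ := (le_Lfun_iff' Q M φ hφ.1.measurable hbd c).1 hc
  have hqk : κ * q = 2 := by rw [hκ]; field_simp
  have hlev := good_level hφ.1.measurable hφ.conc hg M (-(κ * M)) (M + 1 - c) hI hV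
    (by nlinarith) (by
      have : (M - -(κ * M)) * q = M * q + (κ * q) * M := by ring
      rw [this, hqk]
      nlinarith)
  have hvol := vol_lower hφ.1.measurable M (M / 2) (M + 1 - c) hI hV
    (Metric.ball (z + l • (x₀ - z)) (l * r)) measure_ball_lt_top.ne (by
      intro w hw
      have hy : z + l⁻¹ • (w - z) ∈ Metric.ball x₀ r := by
        rw [mem_ball_iff_norm] at hw ⊢
        have e : z + l⁻¹ • (w - z) - x₀ = l⁻¹ • (w - (z + l • (x₀ - z))) := by
          have : w - (z + l • (x₀ - z)) = (w - z) - l • (x₀ - z) := by abel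
          rw [this, smul_sub l⁻¹ (w - z), smul_smul, inv_mul_cancel₀ hlp.ne', one_smul]
          abel
        rw [e, norm_smul, Real.norm_eq_abs, abs_of_pos (by positivity), inv_mul_lt_iff₀ hlp]
        exact hw
      have h1 := hφ.conc z (z + l⁻¹ • (w - z)) (1 - l) l M (-(κ * M)) (by linarith) hlp.le
        (by ring) hMz.le (hlev _ hy)
      have e1 : (1 - l) • z + l • (z + l⁻¹ • (w - z)) = w := by
        rw [smul_add, smul_smul, mul_inv_cancel₀ hlp.ne', sub_smul, one_smul, one_smul]
        abel
      have e2 : (1 - l) * M + l * (-(κ * M)) = M / 2 := by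
        have : (1 - l) * M + l * (-(κ * M)) = M - (l * (1 + κ)) * M := by ring
        rw [this, hl1]; ring
      rw [e1, e2] at h1
      exact h1)
  rw [real_ball_eq, ← hv] at hvol
  have hexp := Real.quadratic_le_exp_of_nonneg (x := M / 2) (by linarith)
  rw [div_lt_iff₀ hvp] at hMv
  have h3 : M ^ 2 / 8 * v ≤ M + 1 - c := by
    refine le_trans ?_ hvol
    gcongr
    nlinarith
  have h4 := neg_abs_le c
  have h5 := abs_nonneg c
  nlinarith

lemma apriori (x₀ : E) (r q c : ℝ) (hr : 0 < r) (hq : 0 < q) :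
    ∃ a b : ℝ, 0 < b ∧ ∀ (Q : Measure E) [IsProbabilityMeasure Q] (φ : E → EReal), IsPhi φ →
      Good Q x₀ r q → (c : EReal) ≤ Lfun φ Q → ∀ x, φ x ≤ ((a - b * ‖x‖ : ℝ) : EReal) := by
  have : ProperSpace E := FiniteDimensional.proper ℝ E
  obtain ⟨M, hM⟩ := apriori_max x₀ r q c hr hq
  set K := |M + 1 - c| / q + 1 - M with hK
  set v := volume.real (Metric.ball (0 : E) (r / 2)) with hv
  have hvp : 0 < v := real_ball_pos _ _ (by positivity)
  set k : ℕ := ⌈(M + 1 - c) * Real.exp (K + 1) / v⌉₊ + 1 with hk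
  have hkgt : (M + 1 - c) * Real.exp (K + 1) / v < k := by
    rw [hk]; push_cast
    exact (Nat.le_ceil _).trans_lt (lt_add_one _)
  have hkp : (0 : ℝ) < k := by rw [hk]; positivity
  set ρ := 2 * r * k with hρ
  have hρp : 0 < ρ := by positivity
  refine ⟨M + 1 + (1 / ρ) * ‖x₀‖, 1 / ρ, by positivity, ?_⟩
  intro Q _ φ hφ hg hc
  have hbd := hM Q φ hφ hg hc
  obtain ⟨hI, hV⟩ := (le_Lfun_iff' Q M φ hφ.1.measurable hbd c).1 hc
  have hlev := good_level hφ.1.measurable hφ.conc hg M (-K) (M + 1 - c) hI hV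
    (by rw [hK]; have : 0 ≤ |M + 1 - c| / q := by positivity
        linarith) (by
      have : (M - -K) * q = |M + 1 - c| + q := by rw [hK]; field_simp; ring
      rw [this]
      linarith [le_abs_self (M + 1 - c)])
  refine hφ.conc.ray_bound x₀ (-K) ρ M hρp (hlev _ (Metric.mem_ball_self hr)) ?_ hbd
  intro x hx
  by_contra hcon
  push Not at hcon
  -- disjoint balls
  let cen : Fin k → E := fun j => x₀ + ((j : ℝ) * r / ρ) • (x - x₀)
  have hdisj : Pairwise (Function.onFun Disjoint fun j => Metric.ball (cen j) (r / 2)) := by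
    intro i j hij
    apply Metric.ball_disjoint_ball
    have e : cen i - cen j = (((i : ℝ) - j) * r / ρ) • (x - x₀) := by
      simp only [cen]
      rw [add_sub_add_left_eq_sub, ← sub_smul]
      congr 1; ring
    rw [dist_eq_norm, e, norm_smul, hx, Real.norm_eq_abs, abs_div, abs_mul, abs_of_pos hr,
      abs_of_pos hρp, div_mul_cancel₀ _ hρp.ne']
    have : (1 : ℝ) ≤ |(i : ℝ) - j| := by
      have h1 : ((i : ℕ) : ℤ) - ((j : ℕ) : ℤ) ≠ 0 := by
        intro h
        apply hij
        ext
        omega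
      have h2 := Int.one_le_abs h1
      have h3 : ((1 : ℤ) : ℝ) ≤ ((|((i : ℕ) : ℤ) - ((j : ℕ) : ℤ)| : ℤ) : ℝ) := by exact_mod_cast h2
      simpa using h3
    nlinarith
  have hS : volume (⋃ j, Metric.ball (cen j) (r / 2)) = (k : ℝ≥0∞) * volume (Metric.ball (0 : E) (r / 2)) := by
    rw [measure_iUnion hdisj (fun _ => measurableSet_ball)]
    simp [Measure.addHaar_ball_center]
  have hfin : volume (⋃ j, Metric.ball (cen j) (r / 2)) ≠ ⊤ := by
    rw [hS]
    exact ENNReal.mul_ne_top (ENNReal.natCast_ne_top _) measure_ball_lt_top.ne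
  have hvol := vol_lower hφ.1.measurable M (-K - 1) (M + 1 - c) hI hV
    (⋃ j, Metric.ball (cen j) (r / 2)) hfin (by
      intro y hy
      rw [mem_iUnion] at hy
      obtain ⟨j, hj⟩ := hy
      set t := (j : ℝ) * r / ρ with ht
      have hjk : ((j : ℕ) : ℝ) < k := by exact_mod_cast j.2
      have ht0 : 0 ≤ t := by positivity
      have ht2 : t ≤ 1 / 2 := by
        rw [ht, div_le_iff₀ hρp, hρ]
        nlinarith
      have h1t : 0 < 1 - t := by linarith
      set w := y - cen j with hw
      have hwn : ‖w‖ < r / 2 := mem_ball_iff_norm.1 hj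
      have hmem : x₀ + (1 - t)⁻¹ • w ∈ Metric.ball x₀ r := by
        rw [mem_ball_iff_norm, add_sub_cancel_left, norm_smul, Real.norm_eq_abs,
          abs_of_pos (by positivity), inv_mul_lt_iff₀ h1t]
        nlinarith
      have h1 : ((-K - 1 : ℝ) : EReal) ≤ φ (x₀ + (1 - t)⁻¹ • w) :=
        le_trans (by exact_mod_cast (by linarith : -K - 1 ≤ -K)) (hlev _ hmem)
      have h2 := hφ.conc x (x₀ + (1 - t)⁻¹ • w) t (1 - t) (-K - 1) (-K - 1) ht0 h1t.le
        (by ring) hcon.le h1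
      have e1 : t • x + (1 - t) • (x₀ + (1 - t)⁻¹ • w) = y := by
        rw [smul_add, smul_smul, mul_inv_cancel₀ h1t.ne', one_smul, hw]
        simp only [cen, ← ht]
        rw [sub_smul, smul_sub, one_smul]
        abel
      have e2 : t * (-K - 1) + (1 - t) * (-K - 1) = -K - 1 := by ring
      rw [e1, e2] at h2
      exact h2)
  rw [Measure.real, hS, ENNReal.toReal_mul, ENNReal.toReal_natCast] at hvol
  change Real.exp (-K - 1) * ((k : ℝ) * v) ≤ M + 1 - c at hvol
  rw [div_lt_iff₀ hvp] at hkgt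
  have h5 : Real.exp (-K - 1) * Real.exp (K + 1) = 1 := by
    rw [← Real.exp_add]; simp
  have h6 := Real.exp_pos (K + 1)
  have h7 := mul_le_mul_of_nonneg_right hvol h6.le
  have h8 : Real.exp (-K - 1) * ((k : ℝ) * v) * Real.exp (K + 1) = k * v := by
    rw [mul_right_comm, h5, one_mul]
  linarith

end
end LCD
namespace LCD
set_option linter.unusedSectionVars false

lemma enn_liminf_add (u v : ℕ → ℝ≥0∞) :
    liminf u atTop + liminf v atTop ≤ liminf (fun n => u n + v n) atTop := by
  rw [liminf_eq_iSup_iInf_of_nat, liminf_eq_iSup_iInf_of_nat, liminf_eq_iSup_iInf_of_nat]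
  have hmono : ∀ w : ℕ → ℝ≥0∞, Monotone fun n => ⨅ i, ⨅ (_ : i ≥ n), w i := by
    intro w m n hmn
    exact le_iInf₂ fun i hi => iInf₂_le i (hmn.trans hi)
  rw [ENNReal.iSup_add_iSup_of_monotone (hmono u) (hmono v)]
  refine iSup_mono fun n => le_iInf₂ fun i hi => ?_
  exact add_le_add (iInf₂_le i hi) (iInf₂_le i hi)

lemma exists_kseq (D : ℕ → ℝ) (h0 : ∀ n, 0 ≤ D n) (hD : Tendsto D atTop (𝓝 0)) :
    ∃ k : ℕ → ℝ, (∀ n, 0 < k n) ∧ Tendsto k atTop atTop ∧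
      Tendsto (fun n => k n * D n) atTop (𝓝 0) := by
  have hp : ∀ n : ℕ, 0 < Real.sqrt (D n) + 1 / ((n : ℝ) + 1) := fun n => by positivity
  have hs : Tendsto (fun n => Real.sqrt (D n)) atTop (𝓝 0) := by
    simpa [Function.comp_def] using (Real.continuous_sqrt.tendsto 0).comp hD
  refine ⟨fun n => (Real.sqrt (D n) + 1 / ((n : ℝ) + 1))⁻¹, fun n => inv_pos.2 (hp n), ?_, ?_⟩
  · apply Tendsto.inv_tendsto_nhdsGT_zero
    rw [tendsto_nhdsWithin_iff]
    refine ⟨?_, Eventually.of_forall hp⟩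
    simpa using hs.add tendsto_one_div_add_atTop_nhds_zero_nat
  · refine squeeze_zero (fun n => mul_nonneg (inv_pos.2 (hp n)).le (h0 n)) (fun n => ?_) hs
    rw [inv_mul_le_iff₀ (hp n)]
    have h1 := Real.mul_self_sqrt (h0 n)
    have h2 : 0 ≤ 1 / ((n : ℝ) + 1) * Real.sqrt (D n) := by positivity
    nlinarith

lemma lint_real {E : Type*} [MeasurableSpace E] (Q : Measure E) [IsProbabilityMeasure Q]
    (g : E → ℝ) (hg : Integrable g Q) (M : ℝ) (hM : ∀ x, g x ≤ M) :
    ∫⁻ x, ENNReal.ofReal (M - g x) ∂Q = ENNReal.ofReal (M - ∫ x, g x ∂Q) := by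
  have h1 : Integrable (fun x => M - g x) Q := (integrable_const M).sub hg
  rw [← ofReal_integral_eq_lintegral_ofReal h1
    (ae_of_all _ fun x => by simpa using hM x), integral_sub (integrable_const M) hg]
  simp

lemma toENN_coe_sub (M t : ℝ) : ((M : EReal) - (t : EReal)).toENNReal = ENNReal.ofReal (M - t) := by
  rw [← EReal.coe_sub, EReal.toENNReal_of_ne_top (EReal.coe_ne_top _), EReal.toReal_coe]

lemma lt_of_ofReal_lt (M β : ℝ) (t : EReal) (h : ENNReal.ofReal β < ((M : EReal) - t).toENNReal) :
    t < ((M - β : ℝ) : EReal) := by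
  by_contra hcon
  push Not at hcon
  have h1 : (M : EReal) - t ≤ (M : EReal) - ((M - β : ℝ) : EReal) := EReal.sub_le_sub le_rfl hcon
  have h2 := EReal.toENNReal_le_toENNReal h1
  rw [toENN_coe_sub, sub_sub_cancel] at h2
  exact absurd h (not_lt.2 h2)

section
variable {E : Type*} [NormedAddCommGroup E] [InnerProductSpace ℝ E] [FiniteDimensional ℝ E]
  [MeasureSpace E] [BorelSpace E] [(volume : Measure E).IsAddHaarMeasure]

lemma integrable_expb (a b : ℝ) (hb : 0 < b) :
    Integrable (fun x : E => Real.exp (a - b * ‖x‖)) volume := by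
  set N := Module.finrank ℝ E + 1 with hN
  have h1 : Integrable (fun x : E => (1 + ‖x‖) ^ (-(N : ℝ))) volume :=
    integrable_one_add_norm (by rw [hN]; push_cast; linarith)
  refine (h1.const_mul (Real.exp a * Real.exp b * N.factorial / b ^ N)).mono'
    (by fun_prop) (ae_of_all _ fun x => ?_)
  rw [Real.norm_eq_abs, abs_of_pos (Real.exp_pos _)]
  have hp : 0 < 1 + ‖x‖ := by positivity
  have h2 := Real.pow_div_factorial_le_exp (b * (1 + ‖x‖)) (by positivity) N
  rw [Real.rpow_neg hp.le, Real.rpow_natCast]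
  have hf : (0 : ℝ) < N.factorial := by exact_mod_cast N.factorial_pos
  have h3 : Real.exp (b * (1 + ‖x‖)) = Real.exp b * Real.exp (b * ‖x‖) := by
    rw [← Real.exp_add]; congr 1; ring
  rw [h3, div_le_iff₀ hf, mul_pow] at h2
  rw [Real.exp_sub]
  rw [div_mul_eq_mul_div, ← div_eq_mul_inv, div_div, div_le_div_iff₀ (Real.exp_pos _) (by positivity)]
  have := mul_le_mul_of_nonneg_left h2 (Real.exp_pos a).le
  calc _ = Real.exp a * (b ^ N * (1 + ‖x‖) ^ N) := by ring
    _ ≤ _ := this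
    _ = _ := by ring

lemma lint_expb (a b : ℝ) (hb : 0 < b) :
    ∫⁻ x : E, ENNReal.ofReal (Real.exp (a - b * ‖x‖)) ≠ ⊤ := by
  rw [← ofReal_integral_eq_lintegral_ofReal (integrable_expb a b hb)
    (ae_of_all _ fun x => (Real.exp_pos _).le)]
  exact ENNReal.ofReal_ne_top

lemma upper_key (Qn : ℕ → Measure E) (Q : Measure E)
    [∀ n, IsProbabilityMeasure (Qn n)] [IsProbabilityMeasure Q]
    (hQn : ∀ n, (∫⁻ x, (‖x‖₊ : ℝ≥0∞) ∂(Qn n)) ≠ ⊤)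
    (hQ : (∫⁻ x, (‖x‖₊ : ℝ≥0∞) ∂Q) ≠ ⊤)
    (hD : Tendsto (fun n => D1 (Qn n) Q) atTop (𝓝 0))
    (φn : ℕ → E → EReal) (φ : E → EReal) (hphi : ∀ n, IsPhi (φn n)) (h : Hypo φn φ)
    (hu : UpperSemicontinuous φ) (hcφ : ConcE φ) (M : ℝ) (hM : ∀ n x, φn n x ≤ M)
    (hMφ : ∀ x, φ x ≤ M) (hne : ∀ n, ∃ z, φn n z ≠ ⊥) (c : ℝ)
    (hc : ∀ᶠ n in atTop, (c : EReal) ≤ Lfun (φn n) (Qn n)) : (c : EReal) ≤ Lfun φ Q := by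
  have : ProperSpace E := FiniteDimensional.proper ℝ E
  have hV : ∀ᶠ n in atTop, 0 ≤ M + 1 - c ∧ Vf M (φn n) (Qn n) ≤ ENNReal.ofReal (M + 1 - c) := by
    filter_upwards [hc] with n hn
    exact (le_Lfun_iff' (Qn n) M (φn n) (hphi n).1.measurable (hM n) c).1 hn
  rw [le_Lfun_iff' Q M φ hu.measurable hMφ c]
  refine ⟨hV.exists.choose_spec.1, ?_⟩
  obtain ⟨k, hk0, hk, hkD⟩ := exists_kseq _ (fun n => D1_nonneg (Qn n) Q) hD
  set g : ℕ → E → ℝ := fun n => supc (k n) (φn n) with hg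
  have hlip : ∀ n, LipschitzWith (k n).toNNReal (g n) := fun n =>
    supc_lipschitz (hM n) (hk0 n).le (hne n)
  have hgM : ∀ n x, g n x ≤ M := fun n x => supc_le_M (hM n) (hk0 n).le (hne n) x
  have hstep : ∀ᶠ n in atTop, (∫⁻ x, ENNReal.ofReal (M - g n x) ∂Q) + ∫⁻ x, EReal.exp (φn n x) ≤
      ENNReal.ofReal (M + 1 - c) + ENNReal.ofReal (k n * D1 (Qn n) Q) := by
    filter_upwards [hV] with n hn
    have i1 := integrable_lip (Qn n) (hQn n) _ (g n) (hlip n)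
    have i2 := integrable_lip Q hQ _ (g n) (hlip n)
    have h1 := D1_lip (Qn n) Q (hQn n) hQ (k n) (hk0 n) (g n) (supc_lip (hM n) (hk0 n).le (hne n))
    rw [abs_le] at h1
    have h2 : ∫⁻ x, ENNReal.ofReal (M - g n x) ∂Q ≤
        (∫⁻ x, ((M : EReal) - φn n x).toENNReal ∂(Qn n)) + ENNReal.ofReal (k n * D1 (Qn n) Q) := by
      rw [lint_real Q (g n) i2 M (hgM n)]
      calc _ ≤ ENNReal.ofReal ((M - ∫ x, g n x ∂(Qn n)) + k n * D1 (Qn n) Q) :=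
            ENNReal.ofReal_le_ofReal (by linarith [h1.2])
        _ ≤ ENNReal.ofReal (M - ∫ x, g n x ∂(Qn n)) + ENNReal.ofReal (k n * D1 (Qn n) Q) :=
            ENNReal.ofReal_add_le
        _ ≤ _ := by
            rw [← lint_real (Qn n) (g n) i1 M (hgM n)]
            gcongr with x
            rw [← toENN_coe_sub]
            apply EReal.toENNReal_le_toENNReal
            exact EReal.sub_le_sub le_rfl (le_supc' (hM n) (hk0 n).le x)
    calc _ ≤ (∫⁻ x, ((M : EReal) - φn n x).toENNReal ∂(Qn n)) + ENNReal.ofReal (k n * D1 (Qn n) Q)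
          + ∫⁻ x, EReal.exp (φn n x) := by gcongr
      _ = Vf M (φn n) (Qn n) + ENNReal.ofReal (k n * D1 (Qn n) Q) := by
          unfold Vf; ring
      _ ≤ _ := by gcongr; exact hn.2
  have hA : ∫⁻ x, ((M : EReal) - φ x).toENNReal ∂Q ≤
      liminf (fun n => ∫⁻ x, ENNReal.ofReal (M - g n x) ∂Q) atTop := by
    refine le_trans (lintegral_mono fun x => ?_) (lintegral_liminf_le fun n => by
      have := (hlip n).continuous.measurable
      fun_prop)
    refine le_of_forall_lt fun b hb => ?_
    obtain ⟨b', hbb', hb'⟩ := exists_between hb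
    refine hbb'.trans_le ?_
    have hbt : b' ≠ ⊤ := (hb'.trans_le le_top).ne
    rw [← ENNReal.ofReal_toReal hbt] at hb' ⊢
    set β := b'.toReal
    have h1 := lt_of_ofReal_lt M β (φ x) hb'
    obtain ⟨V, hV, hVn⟩ := h.1 x _ h1
    obtain ⟨δ, hδ, hδV⟩ := Metric.mem_nhds_iff.1 hV
    refine le_liminf_of_le (by isBoundedDefault) ?_
    have hk' : ∀ᶠ n in atTop, β / δ ≤ k n := hk.eventually_ge_atTop _
    filter_upwards [hVn, hk'] with n hn hkn
    apply ENNReal.ofReal_le_ofReal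
    rw [div_le_iff₀ hδ] at hkn
    have := supc_local (hM n) (hk0 n).le (hne n) x δ (M - β) (fun y hy => (hn y (hδV (by
      rw [Metric.mem_ball, dist_eq_norm, norm_sub_rev]; exact hy))).le) (by linarith)
    change β ≤ M - supc (k n) (φn n) x
    linarith
  have hB : ∫⁻ x, EReal.exp (φ x) ≤ liminf (fun n => ∫⁻ x, EReal.exp (φn n x)) atTop := by
    refine le_trans (lintegral_mono_ae ?_) (lintegral_liminf_le fun n =>
      EReal.measurable_exp.comp (hphi n).1.measurable)
    have hfr : volume (frontier {x | ⊥ < φ x}) = 0 := hcφ.convex_dom.addHaar_frontier _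
    filter_upwards [compl_mem_ae_iff.2 hfr] with x hx
    have h1 := h.tendsto (fun n => (hphi n).conc) x hx (fun _ => x) tendsto_const_nhds
    have h2 := (ENNReal.continuous_exp.tendsto (φ x)).comp h1
    exact h2.liminf_eq.ge
  unfold Vf
  refine (add_le_add hA hB).trans ((enn_liminf_add _ _).trans ?_)
  refine (liminf_le_liminf hstep).trans ?_
  apply le_of_eq
  apply Tendsto.liminf_eq
  have h1 : Tendsto (fun n => ENNReal.ofReal (k n * D1 (Qn n) Q)) atTop (𝓝 0) := by
    simpa [Function.comp_def] using (ENNReal.continuous_ofReal.tendsto 0).comp hkD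
  simpa using h1.const_add (ENNReal.ofReal (M + 1 - c))

theorem compactness (Qn : ℕ → Measure E) (Q : Measure E)
    [∀ n, IsProbabilityMeasure (Qn n)] [IsProbabilityMeasure Q]
    (hQn : ∀ n, (∫⁻ x, (‖x‖₊ : ℝ≥0∞) ∂(Qn n)) ≠ ⊤)
    (hQ : (∫⁻ x, (‖x‖₊ : ℝ≥0∞) ∂Q) ≠ ⊤)
    (hD : Tendsto (fun n => D1 (Qn n) Q) atTop (𝓝 0))
    (x₀ : E) (r q c : ℝ) (hr : 0 < r) (hq : 0 < q) (hg : ∀ n, Good (Qn n) x₀ r q)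
    (φn : ℕ → E → EReal) (hphi : ∀ n, IsPhi (φn n))
    (hc : ∀ n, (c : EReal) ≤ Lfun (φn n) (Qn n)) :
    ∃ (k : ℕ → ℕ) (φ : E → EReal) (a b : ℝ), StrictMono k ∧ IsPhi φ ∧ Hypo (fun j => φn (k j)) φ ∧
      0 < b ∧ (∀ n x, φn n x ≤ ((a - b * ‖x‖ : ℝ) : EReal)) ∧
      (∀ x, φ x ≤ ((a - b * ‖x‖ : ℝ) : EReal)) ∧
      ∀ c' : ℝ, (∀ᶠ j in atTop, (c' : EReal) ≤ Lfun (φn (k j)) (Qn (k j))) →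
        (c' : EReal) ≤ Lfun φ Q := by
  have : ProperSpace E := FiniteDimensional.proper ℝ E
  obtain ⟨a, b, hb, hab⟩ := apriori (E := E) x₀ r q c hr hq
  have hbd : ∀ n x, φn n x ≤ ((a - b * ‖x‖ : ℝ) : EReal) := fun n =>
    hab (Qn n) (φn n) (hphi n) (hg n) (hc n)
  obtain ⟨k, φ, hk, hu, hH⟩ := exists_hypo φn
  have hbφ : ∀ x, φ x ≤ ((a - b * ‖x‖ : ℝ) : EReal) :=
    hH.bound (fun x => a - b * ‖x‖) (by fun_prop) (fun n x => hbd (k n) x)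
  have hcφ : ConcE φ := hH.conc (fun n => (hphi (k n)).conc)
  have hle : ∀ x : E, ((a - b * ‖x‖ : ℝ) : EReal) ≤ (a : EReal) := fun x => by
    rw [EReal.coe_le_coe_iff]
    have : 0 ≤ b * ‖x‖ := by positivity
    linarith
  refine ⟨k, φ, a, b, hk, isPhi_of hu hcφ a b hb hbφ, hH, hb, hbd, hbφ, fun c' hc' => ?_⟩
  exact upper_key (fun j => Qn (k j)) Q (fun j => hQn _) hQ (hD.comp hk.tendsto_atTop)
    (fun j => φn (k j)) φ (fun j => hphi _) hH hu hcφ a (fun n x => (hbd _ x).trans (hle x))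
    (fun x => (hbφ x).trans (hle x)) (fun j => ne_bot_of_Lfun (hphi _) (hc _)) c' hc'

end
end LCD
namespace LCD
set_option linter.unusedSectionVars false
section
variable {E : Type*} [NormedAddCommGroup E] [InnerProductSpace ℝ E] [FiniteDimensional ℝ E]
  [MeasureSpace E] [BorelSpace E] [(volume : Measure E).IsAddHaarMeasure]

lemma Lfun_le_Lprof {φ : E → EReal} (h : IsPhi φ) (Q : Measure E) : Lfun φ Q ≤ Lprof Q :=
  le_iSup₂ (f := fun φ (_ : φ ∈ {φ : E → EReal | IsPhi φ}) => Lfun φ Q) φ h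

lemma exists_of_lt_Lprof {Q : Measure E} {c : EReal} (h : c < Lprof Q) :
    ∃ φ : E → EReal, IsPhi φ ∧ c < Lfun φ Q := by
  unfold Lprof at h
  simp only [lt_iSup_iff] at h
  obtain ⟨φ, h1, h2⟩ := h
  exact ⟨φ, h1, h2⟩

lemma Lfun_phi_lt_top {φ : E → EReal} (h : IsPhi φ) (Q : Measure E) [IsProbabilityMeasure Q] :
    Lfun φ Q < ⊤ := by
  have : ProperSpace E := FiniteDimensional.proper ℝ E
  obtain ⟨a, b, hb, hab⟩ := h.bound
  refine Lfun_lt_top Q a φ h.1.measurable fun x => (hab x).trans ?_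
  rw [EReal.coe_le_coe_iff]
  have : 0 ≤ b * ‖x‖ := by positivity
  linarith

lemma isMLE_iff {Q : Measure E} {ψ : E → EReal} :
    IsMLE Q ψ ↔ IsPhi ψ ∧ Lprof Q ≤ Lfun ψ Q := by
  unfold IsMLE
  refine and_congr_right fun _ => ⟨fun h => iSup₂_le h, fun h φ hφ => (Lfun_le_Lprof hφ Q).trans h⟩

lemma D1_self (Q : Measure E) : D1 Q Q = 0 := by
  apply le_antisymm _ (D1_nonneg Q Q)
  apply Real.sSup_le _ le_rfl
  rintro _ ⟨h, -, rfl⟩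
  simp

lemma supc_isPhi {φ : E → EReal} (h : IsPhi φ) (hne : ∃ z, φ z ≠ ⊥) (a b k : ℝ) (hb : 0 < b)
    (hk : b ≤ k) (hab : ∀ x, φ x ≤ ((a - b * ‖x‖ : ℝ) : EReal)) :
    IsPhi (fun x => (supc k φ x : EReal)) := by
  have hM : ∀ x, φ x ≤ (a : EReal) := fun x => (hab x).trans (by
    rw [EReal.coe_le_coe_iff]
    have : 0 ≤ b * ‖x‖ := by positivity
    linarith)
  have hk0 : 0 ≤ k := hb.le.trans hk
  refine isPhi_of ?_ (supc_conc hM hk0 hne h.conc) a b hb ?_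
  · exact (continuous_coe_real_ereal.comp (supc_lipschitz hM hk0 hne).continuous).upperSemicontinuous
  · intro x
    rw [EReal.coe_le_coe_iff]
    exact supc_bound hne a b hb.le hk hab x

lemma lower_sc (Qn : ℕ → Measure E) (Q : Measure E)
    [∀ n, IsProbabilityMeasure (Qn n)] [IsProbabilityMeasure Q]
    (hQn : ∀ n, (∫⁻ x, (‖x‖₊ : ℝ≥0∞) ∂(Qn n)) ≠ ⊤)
    (hQ : (∫⁻ x, (‖x‖₊ : ℝ≥0∞) ∂Q) ≠ ⊤)
    (hD : Tendsto (fun n => D1 (Qn n) Q) atTop (𝓝 0)) (c : ℝ) (hc : (c : EReal) < Lprof Q) :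
    ∀ᶠ n in atTop, (c : EReal) ≤ Lprof (Qn n) := by
  have : ProperSpace E := FiniteDimensional.proper ℝ E
  obtain ⟨φ, hφ, hcφ⟩ := exists_of_lt_Lprof hc
  obtain ⟨c1, hc1, hc1φ⟩ := EReal.lt_iff_exists_real_btwn.1 hcφ
  have hcc : c < c1 := by exact_mod_cast hc1
  obtain ⟨a, b, hb, hab⟩ := hφ.bound
  have hne := ne_bot_of_Lfun hφ hc1φ.le
  have hM : ∀ x, φ x ≤ (a : EReal) := fun x => (hab x).trans (by
    rw [EReal.coe_le_coe_iff]
    have : 0 ≤ b * ‖x‖ := by positivity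
    linarith)
  obtain ⟨hI, hV⟩ := (le_Lfun_iff' Q a φ hφ.1.measurable hM c1).1 hc1φ.le
  obtain ⟨k, hk0, hk, hkD⟩ := exists_kseq _ (fun n => D1_nonneg (Qn n) Q) hD
  set g : ℕ → E → ℝ := fun n => supc (k n) φ with hg
  have hlip : ∀ n, LipschitzWith (k n).toNNReal (g n) := fun n =>
    supc_lipschitz hM (hk0 n).le hne
  have hgM : ∀ n x, g n x ≤ a := fun n x => supc_le_M hM (hk0 n).le hne x
  have hkb : ∀ᶠ n in atTop, b ≤ k n := hk.eventually_ge_atTop _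
  have hstep : ∀ n, Vf a (fun x => (g n x : EReal)) (Qn n) ≤
      (∫⁻ x, ((a : EReal) - φ x).toENNReal ∂Q) + ENNReal.ofReal (k n * D1 (Qn n) Q) +
        ∫⁻ x, EReal.exp (g n x) := by
    intro n
    unfold Vf
    gcongr
    have i1 := integrable_lip (Qn n) (hQn n) _ (g n) (hlip n)
    have i2 := integrable_lip Q hQ _ (g n) (hlip n)
    have h1 := D1_lip (Qn n) Q (hQn n) hQ (k n) (hk0 n) (g n) (supc_lip hM (hk0 n).le hne)
    rw [abs_le] at h1
    simp_rw [toENN_coe_sub]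
    rw [lint_real (Qn n) (g n) i1 a (hgM n)]
    calc _ ≤ ENNReal.ofReal ((a - ∫ x, g n x ∂Q) + k n * D1 (Qn n) Q) :=
          ENNReal.ofReal_le_ofReal (by linarith [h1.1])
      _ ≤ ENNReal.ofReal (a - ∫ x, g n x ∂Q) + ENNReal.ofReal (k n * D1 (Qn n) Q) :=
          ENNReal.ofReal_add_le
      _ ≤ _ := by
          rw [← lint_real Q (g n) i2 a (hgM n)]
          gcongr with x
          rw [← toENN_coe_sub]
          apply EReal.toENNReal_le_toENNReal
          exact EReal.sub_le_sub le_rfl (le_supc' hM (hk0 n).le x)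
  have hexp : Tendsto (fun n => ∫⁻ x, EReal.exp (g n x)) atTop (𝓝 (∫⁻ x, EReal.exp (φ x))) := by
    refine tendsto_lintegral_filter_of_dominated_convergence
      (fun x => ENNReal.ofReal (Real.exp (a - b * ‖x‖))) ?_ ?_ (lint_expb a b hb) ?_
    · refine Eventually.of_forall fun n => EReal.measurable_exp.comp ?_
      exact (hlip n).continuous.measurable.coe_real_ereal
    · filter_upwards [hkb] with n hn
      refine ae_of_all _ fun x => ?_
      rw [EReal.exp_coe]
      gcongr
      exact supc_bound hne a b hb.le hn hab x
    · refine ae_of_all _ fun x => ?_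
      refine (ENNReal.continuous_exp.tendsto (φ x)).comp ?_
      rw [tendsto_order]
      refine ⟨fun s hs => Eventually.of_forall fun n =>
        hs.trans_le (le_supc' hM (hk0 n).le x), fun s hs => ?_⟩
      obtain ⟨α, hα1, hα2⟩ := EReal.lt_iff_exists_real_btwn.1 hs
      obtain ⟨δ, hδ, hδV⟩ := Metric.mem_nhds_iff.1 (hφ.1 x α hα1)
      have hk' : ∀ᶠ n in atTop, (a - α) / δ ≤ k n := hk.eventually_ge_atTop _
      filter_upwards [hk'] with n hkn
      rw [div_le_iff₀ hδ] at hkn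
      refine lt_of_le_of_lt ?_ hα2
      rw [EReal.coe_le_coe_iff]
      refine supc_local hM (hk0 n).le hne x δ α (fun y hy => ?_) (by linarith)
      have : y ∈ Metric.ball x δ := by
        rw [Metric.mem_ball, dist_eq_norm, norm_sub_rev]; exact hy
      exact (hδV this).le
  have h1 : Tendsto (fun n => ENNReal.ofReal (k n * D1 (Qn n) Q)) atTop (𝓝 0) := by
    simpa [Function.comp_def] using (ENNReal.continuous_ofReal.tendsto 0).comp hkD
  have hlim := (h1.const_add (∫⁻ x, ((a : EReal) - φ x).toENNReal ∂Q)).add hexp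
  rw [add_zero] at hlim
  have hlt : (∫⁻ x, ((a : EReal) - φ x).toENNReal ∂Q) + ∫⁻ x, EReal.exp (φ x) <
      ENNReal.ofReal (a + 1 - c) := by
    refine lt_of_le_of_lt hV ?_
    rw [ENNReal.ofReal_lt_ofReal_iff (by linarith)]
    linarith
  filter_upwards [hlim.eventually_lt_const hlt, hkb] with n hn hkn
  have hphi := supc_isPhi hφ hne a b (k n) hb hkn hab
  refine le_trans ?_ (Lfun_le_Lprof hphi (Qn n))
  rw [le_Lfun_iff' (Qn n) a _ hphi.1.measurable (fun x => by
    rw [EReal.coe_le_coe_iff]; exact hgM n x) c]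
  exact ⟨by linarith, (hstep n).trans hn.le⟩

lemma test_phi (K m : ℝ) (hm : 0 ≤ m) (u : E) (t : ℝ) :
    IsPhi (fun x : E => ((K - ‖x‖ - m * |inner ℝ u x - t| : ℝ) : EReal)) := by
  refine isPhi_of ?_ ?_ K 1 one_pos ?_
  · exact (continuous_coe_real_ereal.comp (by fun_prop)).upperSemicontinuous
  · intro x y a b α β ha hb hab hα hβ
    rw [EReal.coe_le_coe_iff] at *
    have h1 : ‖a • x + b • y‖ ≤ a * ‖x‖ + b * ‖y‖ := by
      refine (norm_add_le _ _).trans ?_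
      rw [norm_smul, norm_smul, Real.norm_eq_abs, Real.norm_eq_abs, abs_of_nonneg ha,
        abs_of_nonneg hb]
    have h2 : |inner ℝ u (a • x + b • y) - t| ≤ a * |inner ℝ u x - t| + b * |inner ℝ u y - t| := by
      rw [inner_add_right, inner_smul_right, inner_smul_right]
      have : a * inner ℝ u x + b * inner ℝ u y - t = a * (inner ℝ u x - t) + b * (inner ℝ u y - t) := by
        have : t = (a + b) * t := by rw [hab, one_mul]
        nlinarith
      rw [this]
      refine (abs_add_le _ _).trans ?_
      rw [abs_mul, abs_mul, abs_of_nonneg ha, abs_of_nonneg hb]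
    have h3 := mul_le_mul_of_nonneg_left h2 hm
    have h4 := mul_le_mul_of_nonneg_left hα ha
    have h5 := mul_le_mul_of_nonneg_left hβ hb
    have h6 : a * K + b * K = K := by rw [← add_mul, hab, one_mul]
    nlinarith
  · intro x
    rw [EReal.coe_le_coe_iff]
    have : 0 ≤ m * |inner ℝ u x - t| := by positivity
    linarith

lemma exists_lt_Lprof (Q : Measure E) [IsProbabilityMeasure Q]
    (hQ : (∫⁻ x, (‖x‖₊ : ℝ≥0∞) ∂Q) ≠ ⊤) : ∃ c : ℝ, (c : EReal) < Lprof Q := by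
  have : ProperSpace E := FiniteDimensional.proper ℝ E
  have hphi := test_phi (E := E) 0 0 le_rfl 0 0
  simp only [zero_mul, sub_zero, zero_sub] at hphi
  set F := ∫ x, ‖x‖ ∂Q
  set I := ∫ x : E, Real.exp (0 - 1 * ‖x‖) with hI
  have hi := integrable_expb (E := E) 0 1 one_pos
  have hI0 : 0 ≤ I := integral_nonneg fun x => (Real.exp_pos _).le
  have hF0 : 0 ≤ F := integral_nonneg fun x => norm_nonneg _
  refine ⟨-F - I, lt_of_lt_of_le (b := ((1 - F - I : ℝ) : EReal))
    (EReal.coe_lt_coe_iff.2 (by linarith)) (le_trans ?_ (Lfun_le_Lprof hphi Q))⟩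
  rw [le_Lfun_iff' Q 0 _ hphi.1.measurable (fun x => by
    rw [EReal.coe_le_coe_iff]; simp) _]
  refine ⟨by linarith, ?_⟩
  unfold Vf
  simp_rw [toENN_coe_sub]
  rw [lint_real Q (fun x => -‖x‖) (integrable_norm_of Q hQ).norm.neg 0 (by simp)]
  have h2 : ∫⁻ x : E, EReal.exp ((-‖x‖ : ℝ) : EReal) = ENNReal.ofReal I := by
    rw [hI, ofReal_integral_eq_lintegral_ofReal hi (ae_of_all _ fun x => (Real.exp_pos _).le)]
    simp only [EReal.exp_coe, zero_sub, one_mul]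
  rw [h2, integral_neg, ← ENNReal.ofReal_add (by simpa using hF0) hI0]
  apply ENNReal.ofReal_le_ofReal
  change 0 - -F + I ≤ _
  linarith

lemma Lprof_top (Q : Measure E) [IsProbabilityMeasure Q]
    (hQ : (∫⁻ x, (‖x‖₊ : ℝ≥0∞) ∂Q) ≠ ⊤) (hNE : ¬ (interior (csupp Q)).Nonempty) :
    Lprof Q = ⊤ := by
  have : ProperSpace E := FiniteDimensional.proper ℝ E
  have hconv : Convex ℝ (csupp Q) := by
    rw [csupp_eq]; exact (convex_convexHull ℝ _).closure
  have hne : (csupp Q).Nonempty := by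
    by_contra hcon
    rw [not_nonempty_iff_eq_empty] at hcon
    have := csupp_full Q
    rw [hcon] at this
    simp at this
  obtain ⟨x₁, hx₁⟩ := hne
  rw [hconv.interior_nonempty_iff_affineSpan_eq_top] at hNE
  have hx₁' : x₁ ∈ affineSpan ℝ (csupp Q) := subset_affineSpan ℝ _ hx₁
  have hdir : (affineSpan ℝ (csupp Q)).direction ≠ ⊤ := by
    rwa [Ne, AffineSubspace.direction_eq_top_iff_of_nonempty ⟨x₁, hx₁'⟩]
  rw [Ne, ← Submodule.orthogonal_eq_bot_iff] at hdir
  obtain ⟨u, hu, hu0⟩ := Submodule.exists_mem_ne_zero_of_ne_bot hdir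
  set t := inner ℝ u x₁ with ht
  have hplane : ∀ x ∈ csupp Q, inner ℝ u x = t := by
    intro x hx
    have h1 : x -ᵥ x₁ ∈ (affineSpan ℝ (csupp Q)).direction :=
      AffineSubspace.vsub_mem_direction (subset_affineSpan ℝ _ hx) hx₁'
    have h2 := (Submodule.mem_orthogonal' _ _).1 hu _ h1
    rw [vsub_eq_sub, inner_sub_right] at h2
    linarith
  have hae : ∀ᵐ x ∂Q, inner ℝ u x = t := by
    filter_upwards [compl_mem_ae_iff.2 (csupp_full Q)] with x hx
    exact hplane x (by simpa using hx)
  have hvol : ∀ᵐ x : E, inner ℝ u x ≠ t := by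
    set S := AffineSubspace.mk' x₁ (LinearMap.ker (innerₛₗ ℝ u)) with hS
    have hSt : S ≠ ⊤ := by
      intro h
      have h1 : x₁ + u ∈ S := by rw [h]; trivial
      rw [hS, AffineSubspace.mem_mk', LinearMap.mem_ker] at h1
      simp at h1
      exact hu0 h1
    have h0 := Measure.addHaar_affineSubspace volume S hSt
    filter_upwards [compl_mem_ae_iff.2 h0] with x hx h
    apply hx
    change x ∈ S
    rw [hS, AffineSubspace.mem_mk', LinearMap.mem_ker]
    simp [inner_sub_right, h, ht]
  rw [EReal.eq_top_iff_forall_lt]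
  intro c0
  suffices ∀ c : ℝ, (c : EReal) ≤ Lprof Q from
    lt_of_lt_of_le (EReal.coe_lt_coe_iff.2 (lt_add_one c0)) (this _)
  intro c
  set F := ∫ x, ‖x‖ ∂Q with hF
  have hF0 : 0 ≤ F := integral_nonneg fun x => norm_nonneg _
  set K := F + c with hK
  have hlim : Tendsto (fun m : ℕ => ∫⁻ x : E, EReal.exp ((K - ‖x‖ - m * |inner ℝ u x - t| : ℝ) : EReal))
      atTop (𝓝 (∫⁻ x : E, 0)) := by
    refine tendsto_lintegral_filter_of_dominated_convergence
      (fun x => ENNReal.ofReal (Real.exp (K - 1 * ‖x‖))) ?_ ?_ (lint_expb K 1 one_pos) ?_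
    · refine Eventually.of_forall fun n => EReal.measurable_exp.comp ?_
      exact (test_phi K n n.cast_nonneg u t).1.measurable
    · refine Eventually.of_forall fun n => ae_of_all _ fun x => ?_
      rw [EReal.exp_coe]
      refine ENNReal.ofReal_le_ofReal (Real.exp_le_exp.2 ?_)
      have : 0 ≤ (n : ℝ) * |inner ℝ u x - t| := by positivity
      linarith
    · filter_upwards [hvol] with x hx
      have hp : 0 < |inner ℝ u x - t| := abs_pos.2 (sub_ne_zero.2 hx)
      simp_rw [EReal.exp_coe]
      rw [← ENNReal.ofReal_zero]
      refine (ENNReal.continuous_ofReal.tendsto 0).comp ?_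
      refine Real.tendsto_exp_atBot.comp ?_
      have h1 : Tendsto (fun n : ℕ => (n : ℝ) * |inner ℝ u x - t|) atTop atTop :=
        tendsto_natCast_atTop_atTop.atTop_mul_const hp
      have h2 := tendsto_atBot_add_const_left atTop (K - ‖x‖) (tendsto_neg_atTop_atBot.comp h1)
      refine h2.congr fun n => ?_
      simp only [Function.comp]
      ring
  rw [lintegral_zero] at hlim
  obtain ⟨m, hm⟩ := (hlim.eventually_lt_const (one_pos)).exists
  have hphi := test_phi K m m.cast_nonneg u t
  refine le_trans ?_ (Lfun_le_Lprof hphi Q)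
  rw [le_Lfun_iff' Q K _ hphi.1.measurable (fun x => by
    rw [EReal.coe_le_coe_iff]
    have : 0 ≤ (m : ℝ) * |inner ℝ u x - t| := by positivity
    linarith [norm_nonneg x]) _]
  refine ⟨by linarith, ?_⟩
  unfold Vf
  simp_rw [toENN_coe_sub]
  have h1 : ∫⁻ x, ENNReal.ofReal (K - (K - ‖x‖ - m * |inner ℝ u x - t|)) ∂Q = ENNReal.ofReal F := by
    rw [hF, ofReal_integral_eq_lintegral_ofReal (integrable_norm_of Q hQ).norm
      (ae_of_all _ fun x => norm_nonneg _)]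
    refine lintegral_congr_ae ?_
    filter_upwards [hae] with x hx
    rw [hx]
    simp
  rw [h1]
  have h2 : K + 1 - c = F + 1 := by rw [hK]; ring
  rw [h2, ENNReal.ofReal_add hF0 zero_le_one, ENNReal.ofReal_one]
  gcongr

lemma exists_mle (Q : Measure E) [IsProbabilityMeasure Q]
    (hQ : (∫⁻ x, (‖x‖₊ : ℝ≥0∞) ∂Q) ≠ ⊤) (hNE : (interior (csupp Q)).Nonempty) :
    ∃ ψ, IsMLE Q ψ := by
  have : ProperSpace E := FiniteDimensional.proper ℝ E
  obtain ⟨x₀, hx₀⟩ := hNE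
  have hD : Tendsto (fun _ : ℕ => D1 Q Q) atTop (𝓝 0) := by
    rw [D1_self]; exact tendsto_const_nhds
  obtain ⟨r, hr, q, hq, hg⟩ := exists_good (fun _ => Q) Q (fun _ => hQ) hQ hD x₀ hx₀
  obtain ⟨_, hg⟩ := hg.exists
  obtain ⟨c, hc⟩ := exists_lt_Lprof Q hQ
  obtain ⟨s, -, hs, hst⟩ := exists_seq_strictMono_tendsto' hc
  choose φn hphi hφn using fun n => exists_of_lt_Lprof (hs n).2
  obtain ⟨k, φ, a, b, hk, hφ, -, -, -, -, hup⟩ := compactness (fun _ => Q) Q (fun _ => hQ) hQ hD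
    x₀ r q c hr hq (fun _ => hg) φn hphi (fun n => ((hs n).1.trans (hφn n)).le)
  refine ⟨φ, isMLE_iff.2 ⟨hφ, ?_⟩⟩
  rw [← EReal.ge_of_forall_gt_iff_ge]
  intro z hz
  apply hup
  filter_upwards [(hst.comp hk.tendsto_atTop).eventually_const_lt hz] with j hj
  exact (hj.trans (hφn _)).le

lemma upper_sc (Qn : ℕ → Measure E) (Q : Measure E)
    [∀ n, IsProbabilityMeasure (Qn n)] [IsProbabilityMeasure Q]
    (hQn : ∀ n, (∫⁻ x, (‖x‖₊ : ℝ≥0∞) ∂(Qn n)) ≠ ⊤)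
    (hQ : (∫⁻ x, (‖x‖₊ : ℝ≥0∞) ∂Q) ≠ ⊤)
    (hD : Tendsto (fun n => D1 (Qn n) Q) atTop (𝓝 0))
    (hNE : (interior (csupp Q)).Nonempty) (s : EReal) (hs : Lprof Q < s) :
    ∀ᶠ n in atTop, Lprof (Qn n) < s := by
  by_contra hcon
  rw [not_eventually] at hcon
  obtain ⟨x₀, hx₀⟩ := hNE
  obtain ⟨r, hr, q, hq, hg⟩ := exists_good Qn Q hQn hQ hD x₀ hx₀
  obtain ⟨l, hl, hl'⟩ := extraction_of_frequently_atTop (hcon.and_eventually hg)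
  obtain ⟨c, hc1, hc2⟩ := EReal.lt_iff_exists_real_btwn.1 hs
  choose φn hphi hφn using fun n => exists_of_lt_Lprof (hc2.trans_le (not_lt.1 (hl' n).1))
  obtain ⟨k, φ, a, b, hk, hφ, -, -, -, -, hup⟩ := compactness (fun n => Qn (l n)) Q (fun n => hQn _) hQ
    (hD.comp hl.tendsto_atTop) x₀ r q c hr hq (fun n => (hl' n).2) φn hphi (fun n => (hφn n).le)
  have := hup c (Eventually.of_forall fun j => (hφn _).le)
  exact absurd (this.trans (Lfun_le_Lprof hφ Q)) (not_le.2 hc1)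

theorem Lprof_tendsto (Qn : ℕ → Measure E) (Q : Measure E)
    [∀ n, IsProbabilityMeasure (Qn n)] [IsProbabilityMeasure Q]
    (hQn : ∀ n, (∫⁻ x, (‖x‖₊ : ℝ≥0∞) ∂(Qn n)) ≠ ⊤)
    (hQ : (∫⁻ x, (‖x‖₊ : ℝ≥0∞) ∂Q) ≠ ⊤)
    (hD : Tendsto (fun n => D1 (Qn n) Q) atTop (𝓝 0)) :
    Tendsto (fun n => Lprof (Qn n)) atTop (𝓝 (Lprof Q)) := by
  rw [tendsto_order]
  refine ⟨fun s hs => ?_, fun s hs => ?_⟩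
  · obtain ⟨c, hc1, hc2⟩ := EReal.lt_iff_exists_real_btwn.1 hs
    filter_upwards [lower_sc Qn Q hQn hQ hD c hc2] with n hn using hc1.trans_le hn
  · by_cases hNE : (interior (csupp Q)).Nonempty
    · exact upper_sc Qn Q hQn hQ hD hNE s hs
    · rw [Lprof_top Q hQ hNE] at hs
      exact absurd hs not_top_lt

end
end LCD
namespace LCD
set_option linter.unusedSectionVars false

/-- Midpoint of two extended reals. -/
noncomputable def emid (s t : EReal) : EReal := ((1 / 2 : ℝ) : EReal) * s + ((1 / 2 : ℝ) : EReal) * t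

lemma emid_coe (p q : ℝ) : emid p q = (((p + q) / 2 : ℝ) : EReal) := by
  unfold emid
  rw [← EReal.coe_mul, ← EReal.coe_mul, ← EReal.coe_add]
  congr 1; ring

lemma emid_bot_left (t : EReal) : emid ⊥ t = ⊥ := by
  unfold emid
  rw [EReal.coe_mul_bot_of_pos (by norm_num), EReal.bot_add]

lemma emid_bot_right (t : EReal) : emid t ⊥ = ⊥ := by
  unfold emid
  rw [EReal.coe_mul_bot_of_pos (by norm_num), EReal.add_bot]

lemma ereal_cases (s : EReal) (hs : s ≠ ⊤) : s = ⊥ ∨ ∃ p : ℝ, s = p := by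
  by_cases h : s = ⊥
  · exact Or.inl h
  · exact Or.inr ⟨s.toReal, (EReal.coe_toReal hs h).symm⟩

lemma ofReal_half (x : ℝ) : ENNReal.ofReal (x / 2) = ENNReal.ofReal x / 2 := by
  rw [ENNReal.ofReal_div_of_pos two_pos]; simp

lemma exp_emid (s t : EReal) (hs : s ≠ ⊤) (ht : t ≠ ⊤) :
    EReal.exp (emid s t) ≤ (EReal.exp s + EReal.exp t) / 2 ∧
    (EReal.exp (emid s t) = (EReal.exp s + EReal.exp t) / 2 → s = t) := by
  rcases ereal_cases s hs with rfl | ⟨p, rfl⟩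
  · rw [emid_bot_left]
    refine ⟨by simp, fun h => ?_⟩
    rw [EReal.exp_bot, zero_add, eq_comm, ENNReal.div_eq_zero_iff] at h
    simpa [eq_comm] using h
  rcases ereal_cases t ht with rfl | ⟨q, rfl⟩
  · rw [emid_bot_right]
    refine ⟨by simp, fun h => ?_⟩
    rw [EReal.exp_bot, add_zero, eq_comm, ENNReal.div_eq_zero_iff] at h
    rcases h with h | h
    · exact absurd (EReal.exp_eq_zero_iff.1 h) (EReal.coe_ne_bot _)
    · simp at h
  rw [emid_coe, EReal.exp_coe, EReal.exp_coe, EReal.exp_coe,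
    ← ENNReal.ofReal_add (Real.exp_pos _).le (Real.exp_pos _).le, ← ofReal_half]
  have h1 : Real.exp p = Real.exp (p / 2) * Real.exp (p / 2) := by
    rw [← Real.exp_add]; congr 1; ring
  have h2 : Real.exp q = Real.exp (q / 2) * Real.exp (q / 2) := by
    rw [← Real.exp_add]; congr 1; ring
  have h3 : Real.exp ((p + q) / 2) = Real.exp (p / 2) * Real.exp (q / 2) := by
    rw [← Real.exp_add]; congr 1; ring
  have h4 := sq_nonneg (Real.exp (p / 2) - Real.exp (q / 2))
  refine ⟨ENNReal.ofReal_le_ofReal (by nlinarith), fun h => ?_⟩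
  rw [ENNReal.ofReal_eq_ofReal_iff (Real.exp_pos _).le (by positivity)] at h
  have h5 : (Real.exp (p / 2) - Real.exp (q / 2)) ^ 2 = 0 := by nlinarith
  have h6 : Real.exp (p / 2) = Real.exp (q / 2) := by
    have := pow_eq_zero_iff (two_ne_zero) |>.1 h5
    linarith
  have h7 := Real.exp_injective h6
  rw [EReal.coe_eq_coe_iff]
  linarith

lemma toENN_emid (M : ℝ) (s t : EReal) (hs : s ≤ M) (ht : t ≤ M) :
    ((M : EReal) - emid s t).toENNReal =
      (((M : EReal) - s).toENNReal + ((M : EReal) - t).toENNReal) / 2 := by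
  have e : ((M : EReal) - ⊥).toENNReal = ⊤ := by simp
  rcases ereal_cases s (hs.trans_lt (EReal.coe_lt_top _)).ne with rfl | ⟨p, rfl⟩
  · rw [emid_bot_left, e, top_add, ENNReal.top_div_of_ne_top (by simp)]
  rcases ereal_cases t (ht.trans_lt (EReal.coe_lt_top _)).ne with rfl | ⟨q, rfl⟩
  · rw [emid_bot_right, e, add_top, ENNReal.top_div_of_ne_top (by simp)]
  rw [EReal.coe_le_coe_iff] at hs ht
  rw [emid_coe, toENN_coe_sub, toENN_coe_sub, toENN_coe_sub,
    ← ENNReal.ofReal_add (by linarith) (by linarith), ← ofReal_half]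
  congr 1; ring

section
variable {E : Type*} [NormedAddCommGroup E] [InnerProductSpace ℝ E] [FiniteDimensional ℝ E]
  [MeasureSpace E] [BorelSpace E] [(volume : Measure E).IsAddHaarMeasure]

lemma emid_phi {φ ψ : E → EReal} (hφ : IsPhi φ) (hψ : IsPhi ψ) :
    IsPhi (fun x => emid (φ x) (ψ x)) := by
  have : ProperSpace E := FiniteDimensional.proper ℝ E
  obtain ⟨a, b, hb, hab⟩ := hφ.bound
  obtain ⟨a', b', hb', hab'⟩ := hψ.bound
  have half_ne_top : ∀ s : EReal, s ≠ ⊤ → ((1 / 2 : ℝ) : EReal) * s ≠ ⊤ := by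
    intro s hs
    rcases ereal_cases s hs with rfl | ⟨p, rfl⟩
    · rw [EReal.coe_mul_bot_of_pos (by norm_num)]; simp
    · rw [← EReal.coe_mul]; exact EReal.coe_ne_top _
  have husc : ∀ θ : E → EReal, UpperSemicontinuous θ →
      UpperSemicontinuous fun x => ((1 / 2 : ℝ) : EReal) * θ x := by
    intro θ hθ
    refine Continuous.comp_upperSemicontinuous (g := fun t : EReal => ((1 / 2 : ℝ) : EReal) * t)
      ?_ hθ ?_
    · rw [continuous_iff_continuousAt]
      intro t
      exact (EReal.continuousAt_mul (p := (((1 / 2 : ℝ) : EReal), t))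
        (Or.inl (by simp)) (Or.inl (by simp)) (Or.inl (by simp)) (Or.inl (by simp))).comp
        (by fun_prop)
    · intro s t hst
      exact mul_le_mul_of_nonneg_left hst (by exact_mod_cast (by norm_num : (0 : ℝ) ≤ 1 / 2))
  refine isPhi_of ?_ ?_ ((a + a') / 2) ((b + b') / 2) (by positivity) ?_
  · refine UpperSemicontinuous.add' (husc φ hφ.1) (husc ψ hψ.1) fun x => ?_
    exact EReal.continuousAt_add (Or.inl (half_ne_top _ (hφ.2.1 x)))
      (Or.inr (half_ne_top _ (hψ.2.1 x)))
  · intro x y l m α β hl hm hlm hα hβ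
    have key : ∀ (z : E) (γ : ℝ), (γ : EReal) ≤ emid (φ z) (ψ z) →
        ∃ p q : ℝ, φ z = p ∧ ψ z = q ∧ γ ≤ (p + q) / 2 := by
      intro z γ hγ
      rcases ereal_cases (φ z) (hφ.2.1 z) with h | ⟨p, hp⟩
      · rw [h, emid_bot_left] at hγ
        exact absurd hγ (not_le.2 (EReal.bot_lt_coe _))
      rcases ereal_cases (ψ z) (hψ.2.1 z) with h | ⟨q, hq⟩
      · rw [h, emid_bot_right] at hγ
        exact absurd hγ (not_le.2 (EReal.bot_lt_coe _))
      rw [hp, hq, emid_coe, EReal.coe_le_coe_iff] at hγ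
      exact ⟨p, q, hp, hq, hγ⟩
    obtain ⟨p, q, hp, hq, h1⟩ := key x α hα
    obtain ⟨p', q', hp', hq', h2⟩ := key y β hβ
    have h3 := hφ.conc x y l m p p' hl hm hlm hp.ge hp'.ge
    have h4 := hψ.conc x y l m q q' hl hm hlm hq.ge hq'.ge
    rcases ereal_cases (φ (l • x + m • y)) (hφ.2.1 _) with h | ⟨P, hP⟩
    · rw [h] at h3; exact absurd h3 (not_le.2 (EReal.bot_lt_coe _))
    rcases ereal_cases (ψ (l • x + m • y)) (hψ.2.1 _) with h | ⟨R, hR⟩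
    · rw [h] at h4; exact absurd h4 (not_le.2 (EReal.bot_lt_coe _))
    simp only
    rw [hP, EReal.coe_le_coe_iff] at h3
    rw [hR, EReal.coe_le_coe_iff] at h4
    rw [hP, hR, emid_coe, EReal.coe_le_coe_iff]
    have h5 := mul_le_mul_of_nonneg_left h1 hl
    have h6 := mul_le_mul_of_nonneg_left h2 hm
    nlinarith
  · intro x
    have h1 := hab x
    have h2 := hab' x
    rcases ereal_cases (φ x) (hφ.2.1 _) with h | ⟨P, hP⟩
    · simp only [h, emid_bot_left]; exact bot_le
    rcases ereal_cases (ψ x) (hψ.2.1 _) with h | ⟨R, hR⟩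
    · simp only [h, emid_bot_right]; exact bot_le
    show emid (φ x) (ψ x) ≤ _
    rw [hP, EReal.coe_le_coe_iff] at h1
    rw [hR, EReal.coe_le_coe_iff] at h2
    rw [hP, hR, emid_coe, EReal.coe_le_coe_iff]
    nlinarith

lemma phi_le_real {φ : E → EReal} (h : IsPhi φ) : ∃ M : ℝ, ∀ x, φ x ≤ M := by
  have : ProperSpace E := FiniteDimensional.proper ℝ E
  obtain ⟨a, b, hb, hab⟩ := h.bound
  refine ⟨a, fun x => (hab x).trans ?_⟩
  rw [EReal.coe_le_coe_iff]
  have : 0 ≤ b * ‖x‖ := by positivity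
  linarith

lemma ae_le_of {φ ψ : E → EReal} (hφ : ConcE φ) (hψ : UpperSemicontinuous ψ)
    (hae : ∀ᵐ x, φ x = ψ x) (x₀ : E) (r K : ℝ) (hr : 0 < r)
    (hK : ∀ w ∈ Metric.ball x₀ r, (K : EReal) ≤ φ w) (y : E) : φ y ≤ ψ y := by
  by_contra hcon
  push Not at hcon
  obtain ⟨a, ha1, ha2⟩ := EReal.lt_iff_exists_real_btwn.1 hcon
  obtain ⟨a', haa, ha'⟩ := EReal.lt_iff_exists_real_btwn.1 ha2
  have haa' : a < a' := by exact_mod_cast haa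
  obtain ⟨δ, hδ, hδV⟩ := Metric.mem_nhds_iff.1 (hψ y a ha1)
  have hev : ∀ᶠ t in 𝓝[>] (0 : ℝ), t < 1 ∧ t * (‖x₀ - y‖ + r) < δ ∧ a < (1 - t) * a' + t * K := by
    have h1 : ∀ᶠ t in 𝓝 (0 : ℝ), t < 1 := eventually_lt_nhds one_pos
    have c2 : ContinuousAt (fun t : ℝ => t * (‖x₀ - y‖ + r)) 0 := by fun_prop
    have c3 : ContinuousAt (fun t : ℝ => (1 - t) * a' + t * K) 0 := by fun_prop
    have h2 : ∀ᶠ t in 𝓝 (0 : ℝ), t * (‖x₀ - y‖ + r) < δ :=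
      c2.eventually_lt_const (by simpa using hδ)
    have h3 : ∀ᶠ t in 𝓝 (0 : ℝ), a < (1 - t) * a' + t * K :=
      c3.eventually_const_lt (by simpa using haa')
    filter_upwards [nhdsWithin_le_nhds h1, nhdsWithin_le_nhds h2, nhdsWithin_le_nhds h3] with t a b c
    exact ⟨a, b, c⟩
  obtain ⟨t, ⟨ht1, htδ, hta⟩, ht0⟩ := (hev.and self_mem_nhdsWithin).exists
  have ht0 : 0 < t := ht0
  have hsub : Metric.ball (y + t • (x₀ - y)) (t * r) ⊆ {x | φ x = ψ x}ᶜ := by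
    intro z hz
    rw [mem_ball_iff_norm] at hz
    set w := y + t⁻¹ • (z - y) with hw
    have e1 : w - x₀ = t⁻¹ • (z - (y + t • (x₀ - y))) := by
      rw [← sub_sub, smul_sub t⁻¹ (z - y), smul_smul, inv_mul_cancel₀ ht0.ne', one_smul, hw]
      abel
    have hwm : w ∈ Metric.ball x₀ r := by
      rw [mem_ball_iff_norm, e1, norm_smul, Real.norm_eq_abs, abs_of_pos (by positivity),
        inv_mul_lt_iff₀ ht0]
      exact hz
    have e2 : (1 - t) • y + t • w = z := by
      rw [hw, smul_add, smul_smul, mul_inv_cancel₀ ht0.ne', one_smul, sub_smul, one_smul]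
      abel
    have h1 := hφ y w (1 - t) t a' K (by linarith) ht0.le (by ring) ha'.le (hK w hwm)
    rw [e2] at h1
    have h2 : (a : EReal) < φ z := lt_of_lt_of_le (EReal.coe_lt_coe_iff.2 hta) h1
    have h3 : z ∈ Metric.ball y δ := by
      rw [mem_ball_iff_norm]
      have : z - y = (z - (y + t • (x₀ - y))) + t • (x₀ - y) := by abel
      rw [this]
      refine (norm_add_le _ _).trans_lt ?_
      rw [norm_smul, Real.norm_eq_abs, abs_of_pos ht0]
      nlinarith
    have h4 : ψ z < a := hδV h3
    exact (h4.trans h2).ne'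
  have h0 : volume {x | φ x = ψ x}ᶜ = 0 := hae
  have := Metric.measure_ball_pos volume (y + t • (x₀ - y)) (mul_pos ht0 hr)
  exact absurd (measure_mono_null hsub h0) this.ne'

lemma mle_unique (Q : Measure E) [IsProbabilityMeasure Q]
    (hQ : (∫⁻ x, (‖x‖₊ : ℝ≥0∞) ∂Q) ≠ ⊤) (hNE : (interior (csupp Q)).Nonempty)
    (φ ψ : E → EReal) (hφ : IsMLE Q φ) (hψ : IsMLE Q ψ) : φ = ψ := by
  have : ProperSpace E := FiniteDimensional.proper ℝ E
  obtain ⟨x₀, hx₀⟩ := hNE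
  have hD : Tendsto (fun _ : ℕ => D1 Q Q) atTop (𝓝 0) := by
    rw [D1_self]; exact tendsto_const_nhds
  obtain ⟨r, hr, q, hq, hg⟩ := exists_good (fun _ => Q) Q (fun _ => hQ) hQ hD x₀ hx₀
  obtain ⟨_, hg⟩ := hg.exists
  rw [isMLE_iff] at hφ hψ
  obtain ⟨c0, hc0⟩ := exists_lt_Lprof Q hQ
  have hLt : Lprof Q < ⊤ := hφ.2.trans_lt (Lfun_phi_lt_top hφ.1 Q)
  set c := (Lprof Q).toReal with hc
  have hcL : (c : EReal) = Lprof Q := EReal.coe_toReal hLt.ne ((EReal.bot_lt_coe _).trans hc0).ne'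
  obtain ⟨M1, hM1⟩ := phi_le_real hφ.1
  obtain ⟨M2, hM2⟩ := phi_le_real hψ.1
  set M := max M1 M2
  have hMφ : ∀ x, φ x ≤ M := fun x => (hM1 x).trans (EReal.coe_le_coe_iff.2 (le_max_left _ _))
  have hMψ : ∀ x, ψ x ≤ M := fun x => (hM2 x).trans (EReal.coe_le_coe_iff.2 (le_max_right _ _))
  obtain ⟨hI, hV1⟩ := (le_Lfun_iff' Q M φ hφ.1.1.measurable hMφ c).1 (hcL ▸ hφ.2)
  obtain ⟨-, hV2⟩ := (le_Lfun_iff' Q M ψ hψ.1.1.measurable hMψ c).1 (hcL ▸ hψ.2)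
  set I := M + 1 - c with hIdef
  set χ : E → EReal := fun x => emid (φ x) (ψ x) with hχdef
  have hχ : IsPhi χ := emid_phi hφ.1 hψ.1
  have hMχ : ∀ x, χ x ≤ M := by
    intro x
    have h1 := hMφ x
    have h2 := hMψ x
    simp only [hχdef]
    rcases ereal_cases (φ x) (hφ.1.2.1 _) with h | ⟨P, hP⟩
    · rw [h, emid_bot_left]; exact bot_le
    rcases ereal_cases (ψ x) (hψ.1.2.1 _) with h | ⟨R, hR⟩
    · rw [h, emid_bot_right]; exact bot_le
    rw [hP, EReal.coe_le_coe_iff] at h1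
    rw [hR, EReal.coe_le_coe_iff] at h2
    rw [hP, hR, emid_coe, EReal.coe_le_coe_iff]
    linarith
  -- the profile value cannot be exceeded
  have hVχ : ENNReal.ofReal I ≤ Vf M χ Q := by
    by_contra hcon
    push Not at hcon
    have hfin : Vf M χ Q ≠ ⊤ := (hcon.trans_le le_top).ne
    set j := (Vf M χ Q).toReal with hj
    have hjI : j < I := by
      rw [← ENNReal.ofReal_toReal hfin] at hcon
      exact (ENNReal.ofReal_lt_ofReal_iff_of_nonneg ENNReal.toReal_nonneg).1 hcon
    have h1 : ((M + 1 - j : ℝ) : EReal) ≤ Lfun χ Q := by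
      rw [le_Lfun_iff' Q M χ hχ.1.measurable hMχ]
      have e : M + 1 - (M + 1 - j) = j := by ring
      rw [e]
      exact ⟨ENNReal.toReal_nonneg, (ENNReal.ofReal_toReal hfin).ge⟩
    have h2 := h1.trans (Lfun_le_Lprof hχ Q)
    rw [← hcL, EReal.coe_le_coe_iff] at h2
    linarith
  have mφ : Measurable fun x => EReal.exp (φ x) := EReal.measurable_exp.comp hφ.1.1.measurable
  have mψ : Measurable fun x => EReal.exp (ψ x) := EReal.measurable_exp.comp hψ.1.1.measurable
  have mφ' : Measurable fun x => ((M : EReal) - φ x).toENNReal := by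
    have := hφ.1.1.measurable
    fun_prop
  set A1 := ∫⁻ x, ((M : EReal) - φ x).toENNReal ∂Q with hA1
  set A2 := ∫⁻ x, ((M : EReal) - ψ x).toENNReal ∂Q with hA2
  set B1 := ∫⁻ x, EReal.exp (φ x) with hB1
  set B2 := ∫⁻ x, EReal.exp (ψ x) with hB2
  set B := ∫⁻ x, EReal.exp (χ x) with hB
  have hAχ : ∫⁻ x, ((M : EReal) - χ x).toENNReal ∂Q = (A1 + A2) / 2 := by
    rw [hA1, hA2, ← lintegral_add_left mφ', div_eq_mul_inv, ← lintegral_mul_const' _ _ (by simp)]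
    refine lintegral_congr fun x => ?_
    rw [← div_eq_mul_inv]
    exact toENN_emid M _ _ (hMφ x) (hMψ x)
  have hBavg : ∫⁻ x, (EReal.exp (φ x) + EReal.exp (ψ x)) / 2 = (B1 + B2) / 2 := by
    rw [hB1, hB2, ← lintegral_add_left mφ, div_eq_mul_inv, ← lintegral_mul_const' _ _ (by simp)]
    rfl
  have hV1' : A1 + B1 ≤ ENNReal.ofReal I := hV1
  have hV2' : A2 + B2 ≤ ENNReal.ofReal I := hV2
  have hVχ' : ENNReal.ofReal I ≤ (A1 + A2) / 2 + B := by
    rw [← hAχ]; exact hVχ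
  have hB1f : B1 ≠ ⊤ := ((le_add_self.trans hV1').trans_lt ENNReal.ofReal_lt_top).ne
  have hB2f : B2 ≠ ⊤ := ((le_add_self.trans hV2').trans_lt ENNReal.ofReal_lt_top).ne
  have hA1f : A1 ≠ ⊤ := ((le_self_add.trans hV1').trans_lt ENNReal.ofReal_lt_top).ne
  have hA2f : A2 ≠ ⊤ := ((le_self_add.trans hV2').trans_lt ENNReal.ofReal_lt_top).ne
  have hpt : ∀ x, EReal.exp (χ x) ≤ (EReal.exp (φ x) + EReal.exp (ψ x)) / 2 := fun x =>
    (exp_emid (φ x) (ψ x) (hφ.1.2.1 x) (hψ.1.2.1 x)).1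
  have hBle : B ≤ (B1 + B2) / 2 := by
    rw [← hBavg]; exact lintegral_mono hpt
  have hfin2 : (B1 + B2) / 2 ≠ ⊤ := by
    apply ENNReal.div_ne_top (ENNReal.add_ne_top.2 ⟨hB1f, hB2f⟩) (by simp)
  have hBf : B ≠ ⊤ := (hBle.trans_lt (lt_top_iff_ne_top.2 hfin2)).ne
  have hge : (B1 + B2) / 2 ≤ B := by
    have h1 : (A1 + A2) / 2 + (B1 + B2) / 2 ≤ (A1 + A2) / 2 + B := by
      refine le_trans ?_ hVχ'
      rw [← ENNReal.add_div]
      refine ENNReal.div_le_of_le_mul ?_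
      calc A1 + A2 + (B1 + B2) = (A1 + B1) + (A2 + B2) := by ring
        _ ≤ ENNReal.ofReal I + ENNReal.ofReal I := add_le_add hV1' hV2'
        _ = ENNReal.ofReal I * 2 := by ring
    exact (ENNReal.add_le_add_iff_left
      (ENNReal.div_ne_top (ENNReal.add_ne_top.2 ⟨hA1f, hA2f⟩) (by simp))).1 h1
  have hae : ∀ᵐ x, φ x = ψ x := by
    have h1 := ae_eq_of_ae_le_of_lintegral_le (μ := volume) (ae_of_all _ hpt) hBf
      ((mφ.add mψ).div_const 2).aemeasurable (by rw [hBavg]; exact hge)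
    filter_upwards [h1] with x hx
    exact (exp_emid (φ x) (ψ x) (hφ.1.2.1 x) (hψ.1.2.1 x)).2 hx
  have hlt : I < (M - (M - I / q - 1)) * q := by
    have : (M - (M - I / q - 1)) * q = I + q := by field_simp; ring
    rw [this]; linarith
  have hle : M - I / q - 1 ≤ M := by
    have : 0 ≤ I / q := by positivity
    linarith
  have l1 := good_level hφ.1.1.measurable hφ.1.conc hg M (M - I / q - 1) I hI hV1 hle hlt
  have l2 := good_level hψ.1.1.measurable hψ.1.conc hg M (M - I / q - 1) I hI hV2 hle hlt
  funext y
  apply le_antisymm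
  · exact ae_le_of hφ.1.conc hψ.1.1 hae x₀ r _ hr l1 y
  · exact ae_le_of hψ.1.conc hφ.1.1 (hae.mono fun x hx => hx.symm) x₀ r _ hr l2 y

end
end LCD
namespace LCD
set_option linter.unusedSectionVars false

lemma exp_ne_top' {s : EReal} (hs : s ≠ ⊤) : EReal.exp s ≠ ⊤ := by
  rcases ereal_cases s hs with rfl | ⟨p, rfl⟩
  · simp
  · rw [EReal.exp_coe]; exact ENNReal.ofReal_ne_top

lemma expR_nonneg (s : EReal) : 0 ≤ EReal.expR s := ENNReal.toReal_nonneg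

lemma expR_mono {s t : EReal} (ht : t ≠ ⊤) (h : s ≤ t) : EReal.expR s ≤ EReal.expR t :=
  ENNReal.toReal_mono (exp_ne_top' ht) (EReal.exp_monotone h)

lemma expR_coe (p : ℝ) : EReal.expR (p : EReal) = Real.exp p := by
  unfold EReal.expR
  rw [EReal.exp_coe, ENNReal.toReal_ofReal (Real.exp_pos _).le]

lemma expR_pos_iff {s : EReal} (hs : s ≠ ⊤) : 0 < EReal.expR s ↔ ⊥ < s := by
  rcases ereal_cases s hs with rfl | ⟨p, rfl⟩
  · simp [EReal.expR]
  · rw [expR_coe]; simp [Real.exp_pos]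

lemma expR_tendsto {u : ℕ → EReal} {s : EReal} (hs : s ≠ ⊤) (h : Tendsto u atTop (𝓝 s)) :
    Tendsto (fun n => EReal.expR (u n)) atTop (𝓝 (EReal.expR s)) :=
  (ENNReal.tendsto_toReal (exp_ne_top' hs)).comp ((ENNReal.continuous_exp.tendsto s).comp h)

section
variable {E : Type*} [NormedAddCommGroup E] [InnerProductSpace ℝ E] [FiniteDimensional ℝ E]
  [MeasureSpace E] [BorelSpace E] [(volume : Measure E).IsAddHaarMeasure]

theorem main_aux (Qn : ℕ → Measure E) (Q : Measure E)
    [∀ n, IsProbabilityMeasure (Qn n)] [IsProbabilityMeasure Q]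
    (hQn : ∀ n, (∫⁻ x, (‖x‖₊ : ℝ≥0∞) ∂(Qn n)) ≠ ⊤)
    (hQ : (∫⁻ x, (‖x‖₊ : ℝ≥0∞) ∂Q) ≠ ⊤)
    (hD : Tendsto (fun n => D1 (Qn n) Q) atTop (𝓝 0))
    (hNE : (interior (csupp Q)).Nonempty) (ψ : E → EReal) (hψ : IsMLE Q ψ) :
    ∃ (N : ℕ) (ψn : ℕ → E → EReal), (∀ n, N ≤ n → IsMLE (Qn n) (ψn n)) ∧ (∀ n, IsPhi (ψn n)) ∧
      ∀ ns : ℕ → ℕ, Tendsto ns atTop atTop → ∃ (ms : ℕ → ℕ) (a b : ℝ), Tendsto ms atTop atTop ∧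
        0 < b ∧ (∀ j x, ψn (ns (ms j)) x ≤ ((a - b * ‖x‖ : ℝ) : EReal)) ∧
        (∀ x, ψ x ≤ ((a - b * ‖x‖ : ℝ) : EReal)) ∧ Hypo (fun j => ψn (ns (ms j))) ψ := by
  classical
  have hNE' := hNE
  obtain ⟨x₀, hx₀⟩ := hNE
  obtain ⟨r, hr, q, hq, hg⟩ := exists_good Qn Q hQn hQ hD x₀ hx₀
  obtain ⟨c, hc⟩ := exists_lt_Lprof Q hQ
  obtain ⟨N, hN⟩ := eventually_atTop.1 (hg.and (lower_sc Qn Q hQn hQ hD c hc))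
  have hex : ∀ n, ∃ θ : E → EReal, IsPhi θ ∧ (N ≤ n → IsMLE (Qn n) θ) := by
    intro n
    by_cases hn : N ≤ n
    · obtain ⟨θ, hθ⟩ := exists_mle (Qn n) (hQn n) ⟨x₀, (hN n hn).1.csupp hr hq⟩
      exact ⟨θ, hθ.1, fun _ => hθ⟩
    · exact ⟨ψ, hψ.1, fun h => absurd h hn⟩
  choose ψn hphi hmle using hex
  refine ⟨N, ψn, hmle, hphi, fun ns hns => ?_⟩
  obtain ⟨J, hJ⟩ := eventually_atTop.1 (hns.eventually_ge_atTop N)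
  have hsh : Tendsto (fun j : ℕ => ns (j + J)) atTop atTop :=
    hns.comp (tendsto_add_atTop_nat J)
  have hge : ∀ j, N ≤ ns (j + J) := fun j => hJ _ (by omega)
  have hlow : ∀ j, Lprof (Qn (ns (j + J))) ≤ Lfun (ψn (ns (j + J))) (Qn (ns (j + J))) :=
    fun j => (isMLE_iff.1 (hmle _ (hge j))).2
  obtain ⟨k, φ, a, b, hk, hφ, hyp, hb, hbn, hbφ, hup⟩ :=
    compactness (fun j => Qn (ns (j + J))) Q (fun _ => hQn _) hQ (hD.comp hsh) x₀ r q c hr hq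
      (fun j => (hN _ (hge j)).1) (fun j => ψn (ns (j + J))) (fun _ => hphi _)
      (fun j => (hN _ (hge j)).2.trans (hlow j))
  have hLt := (Lprof_tendsto Qn Q hQn hQ hD).comp (hsh.comp hk.tendsto_atTop)
  have hφm : IsMLE Q φ := by
    refine isMLE_iff.2 ⟨hφ, ?_⟩
    rw [← EReal.ge_of_forall_gt_iff_ge]
    intro z hz
    apply hup
    filter_upwards [hLt.eventually_const_lt hz] with j hj
    exact hj.le.trans (hlow _)
  have hEq := mle_unique Q hQ hNE' φ ψ hφm hψ
  subst hEq
  refine ⟨fun j => k j + J, a, b, (tendsto_add_atTop_nat J).comp hk.tendsto_atTop, hb,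
    fun j x => hbn (k j) x, hbφ, hyp⟩

theorem main_aux2 (Qn : ℕ → Measure E) (Q : Measure E)
    [∀ n, IsProbabilityMeasure (Qn n)] [IsProbabilityMeasure Q]
    (hQn : ∀ n, (∫⁻ x, (‖x‖₊ : ℝ≥0∞) ∂(Qn n)) ≠ ⊤)
    (hQ : (∫⁻ x, (‖x‖₊ : ℝ≥0∞) ∂Q) ≠ ⊤)
    (hD : Tendsto (fun n => D1 (Qn n) Q) atTop (𝓝 0))
    (hNE : (interior (csupp Q)).Nonempty) (ψ : E → EReal) (hψ : IsMLE Q ψ) :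
    ∃ (N : ℕ) (ψn : ℕ → E → EReal), (∀ n, N ≤ n → IsMLE (Qn n) (ψn n)) ∧
        (∀ y : E, y ∉ frontier {x | 0 < EReal.expR (ψ x)} →
          ∀ x : ℕ → E, Tendsto x atTop (𝓝 y) →
            Tendsto (fun n => EReal.expR (ψn n (x n))) atTop (𝓝 (EReal.expR (ψ y)))) ∧
        (∀ y ∈ frontier {x | 0 < EReal.expR (ψ x)},
          ∀ x : ℕ → E, Tendsto x atTop (𝓝 y) →
            Filter.limsup (fun n => EReal.expR (ψn n (x n))) atTop ≤ EReal.expR (ψ y)) ∧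
        Tendsto (fun n => ∫ x, |EReal.expR (ψn n x) - EReal.expR (ψ x)|) atTop (𝓝 0) := by
  obtain ⟨N, ψn, hmle, hphi, hS⟩ := main_aux Qn Q hQn hQ hD hNE ψ hψ
  have hset : {x | 0 < EReal.expR (ψ x)} = {x | ⊥ < ψ x} := by
    ext x; exact expR_pos_iff (hψ.1.2.1 x)
  rw [hset]
  have hlim1 : ∀ y : E, y ∉ frontier {x | ⊥ < ψ x} →
          ∀ x : ℕ → E, Tendsto x atTop (𝓝 y) →
            Tendsto (fun n => EReal.expR (ψn n (x n))) atTop (𝓝 (EReal.expR (ψ y))) := by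
    intro y hy x hx
    apply tendsto_of_subseq_tendsto
    intro ns hns
    obtain ⟨ms, a, b, hms, hb, -, -, hyp⟩ := hS ns hns
    refine ⟨ms, expR_tendsto (hψ.1.2.1 y) ?_⟩
    exact hyp.tendsto (fun j => (hphi _).conc) y hy (fun j => x (ns (ms j)))
      (hx.comp (hns.comp hms))
  refine ⟨N, ψn, hmle, hlim1, ?_, ?_⟩
  · intro y _ x hx
    have ht : Tendsto (fun n => EReal.expR (max (ψn n (x n)) (ψ y))) atTop
        (𝓝 (EReal.expR (ψ y))) := by
      apply tendsto_of_subseq_tendsto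
      intro ns hns
      obtain ⟨ms, a, b, hms, hb, -, -, hyp⟩ := hS ns hns
      refine ⟨ms, expR_tendsto (hψ.1.2.1 y) ?_⟩
      rw [tendsto_order]
      refine ⟨fun s hs => Eventually.of_forall fun j => lt_max_of_lt_right hs, fun s hs => ?_⟩
      filter_upwards [hyp.tendsto_bot (fun j => x (ns (ms j))) y
        (hx.comp (hns.comp hms)) s hs] with j hj
      exact max_lt hj hs
    rw [← ht.limsup_eq]
    refine limsup_le_limsup (Eventually.of_forall fun n => ?_) ?_ ht.isBoundedUnder_le
    · refine expR_mono ?_ (le_max_left _ _)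
      rcases max_choice (ψn n (x n)) (ψ y) with h | h <;> rw [h]
      · exact (hphi n).2.1 _
      · exact hψ.1.2.1 _
    · exact IsBoundedUnder.isCoboundedUnder_le
        ⟨0, eventually_map.2 (Eventually.of_forall fun n => expR_nonneg _)⟩
  · apply tendsto_of_subseq_tendsto
    intro ns hns
    obtain ⟨ms, a, b, hms, hb, hbn, hbψ, hyp⟩ := hS ns hns
    refine ⟨ms, ?_⟩
    have hmeas : ∀ θ : E → EReal, IsPhi θ → Measurable fun x => EReal.expR (θ x) := fun θ hθ =>
      (EReal.measurable_exp.comp hθ.1.measurable).ennreal_toReal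
    have hbd : ∀ (s : EReal) (t : ℝ), s ≤ t → EReal.expR s ≤ Real.exp t := fun s t h => by
      rw [← expR_coe]; exact expR_mono (EReal.coe_ne_top _) h
    have hfr : volume (frontier {x | ⊥ < ψ x}) = 0 := hψ.1.conc.convex_dom.addHaar_frontier _
    have key := tendsto_integral_of_dominated_convergence (μ := (volume : Measure E))
      (F := fun j x => |EReal.expR (ψn (ns (ms j)) x) - EReal.expR (ψ x)|) (f := fun _ => 0)
      (fun x => Real.exp (a - b * ‖x‖)) (fun j => ?_) (integrable_expb a b hb) (fun j => ?_) ?_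
    · simpa using key
    · exact ((hmeas _ (hphi _)).sub (hmeas _ hψ.1)).abs.aestronglyMeasurable
    · refine ae_of_all _ fun x => ?_
      rw [Real.norm_eq_abs, abs_abs, abs_le]
      have h1 := hbd _ _ (hbn j x)
      have h2 := hbd _ _ (hbψ x)
      have h3 := expR_nonneg (ψn (ns (ms j)) x)
      have h4 := expR_nonneg (ψ x)
      constructor <;> linarith
    · filter_upwards [compl_mem_ae_iff.2 hfr] with x hx
      have h1 := (hlim1 x hx (fun _ => x) tendsto_const_nhds).comp (hns.comp hms)
      have h2 := (h1.sub_const (EReal.expR (ψ x))).abs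
      simpa using h2

end
end LCD

/-- **Theorem 4 (continuity with respect to Mallows distance `D₁`).** If `D₁(Q_n, Q) → 0`
for distributions with finite first moments, then `L(Q_n) → L(Q)` in `[-∞, ∞]`; and if
moreover `csupp Q` has nonempty interior, the densities `f = exp ∘ ψ(·|Q)` and
`f_n = exp ∘ ψ(·|Q_n)` are well defined for large `n` and satisfy
`f_n(x) → f(y)` as `n → ∞, x → y` off the boundary of `{f > 0}`,
`limsup f_n(x) ≤ f(y)` on that boundary, and `∫ |f_n - f| → 0`. -/
theorem Lprof_mallows_continuity {d : ℕ}
    (Qn : ℕ → Measure (EuclideanSpace ℝ (Fin d))) (Q : Measure (EuclideanSpace ℝ (Fin d)))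
    [∀ n, IsProbabilityMeasure (Qn n)] [IsProbabilityMeasure Q]
    (hQn : ∀ n, (∫⁻ x, (‖x‖₊ : ℝ≥0∞) ∂(Qn n)) ≠ ⊤)
    (hQ : (∫⁻ x, (‖x‖₊ : ℝ≥0∞) ∂Q) ≠ ⊤)
    (hD : Tendsto (fun n => D1 (Qn n) Q) atTop (𝓝 0)) :
    Tendsto (fun n => Lprof (Qn n)) atTop (𝓝 (Lprof Q)) ∧
    ((interior (csupp Q)).Nonempty →
      ∀ ψ : EuclideanSpace ℝ (Fin d) → EReal, IsMLE Q ψ →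
      ∃ (N : ℕ) (ψn : ℕ → EuclideanSpace ℝ (Fin d) → EReal),
        (∀ n, N ≤ n → IsMLE (Qn n) (ψn n)) ∧
        (∀ y : EuclideanSpace ℝ (Fin d), y ∉ frontier {x | 0 < EReal.expR (ψ x)} →
          ∀ x : ℕ → EuclideanSpace ℝ (Fin d), Tendsto x atTop (𝓝 y) →
            Tendsto (fun n => EReal.expR (ψn n (x n))) atTop (𝓝 (EReal.expR (ψ y)))) ∧
        (∀ y ∈ frontier {x | 0 < EReal.expR (ψ x)},
          ∀ x : ℕ → EuclideanSpace ℝ (Fin d), Tendsto x atTop (𝓝 y) →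
            Filter.limsup (fun n => EReal.expR (ψn n (x n))) atTop ≤ EReal.expR (ψ y)) ∧
        Tendsto (fun n => ∫ x, |EReal.expR (ψn n x) - EReal.expR (ψ x)|) atTop (𝓝 0)) := by
  exact ⟨LCD.Lprof_tendsto Qn Q hQn hQ hD, fun hNE ψ hψ =>
    LCD.main_aux2 Qn Q hQn hQ hD hNE ψ hψ⟩
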